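/- Let 𝒞 be an arrangement of m ≥ 2 cameras with pairwise distinct centers such that no four camera centers are collinear. Then the quotient ring R/I_𝒞 is reduced; equivalently, the ideal I_𝒞 generated by the 3×3 minors of M(ℓ) is a radical ideal. -/

import Mathlib

open MvPolynomial

noncomputable section

abbrev Vec3 := Fin 3 → ℂ
abbrev Vec4 := Fin 4 → ℂ
abbrev Camera := Matrix (Fin 3) (Fin 4) ℂ

/-- The polynomial ring `R = ℂ[ℓ_{i,j} : 1 ≤ i ≤ 3, 1 ≤ j ≤ m]`. -/
abbrev LineRing (m : ℕ) := MvPolynomial (Fin 3 × Fin m) ℂ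

/-- `c` is (a representative of) the center of the camera `C`. -/
def IsCenter (C : Camera) (c : Vec4) : Prop := c ≠ 0 ∧ C.mulVec c = 0

/-- A camera arrangement: `m ≥ 2` cameras of rank 3 with pairwise distinct centers. -/
def IsCameraArrangement {m : ℕ} (𝒞 : Fin m → Camera) : Prop :=
  2 ≤ m ∧ (∀ i, (𝒞 i).rank = 3) ∧
    ∀ i j : Fin m, i ≠ j → ¬ ∃ c : Vec4, IsCenter (𝒞 i) c ∧ IsCenter (𝒞 j) c

/-- The cameras indexed by `S` have collinear centers: all of their centers lie on a
common projective line in ℙ³, i.e. in a common linear subspace of dimension ≤ 2 of ℂ⁴. -/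
def CollinearCenters {m : ℕ} (𝒞 : Fin m → Camera) (S : Set (Fin m)) : Prop :=
  ∃ W : Submodule ℂ Vec4, Module.finrank ℂ W ≤ 2 ∧
    ∀ i ∈ S, ∃ c : Vec4, IsCenter (𝒞 i) c ∧ c ∈ W

/-- No four camera centers are collinear. -/
def NoFourCollinear {m : ℕ} (𝒞 : Fin m → Camera) : Prop :=
  ∀ S : Finset (Fin m), S.card = 4 → ¬ CollinearCenters 𝒞 ↑S

/-- The 4×m matrix `M(ℓ)` of polynomials whose `j`-th column is `C_jᵀ ℓ_j`,
where the entries of `ℓ_j` are the variables `ℓ_{i,j}`. -/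
def MmatPoly {m : ℕ} (𝒞 : Fin m → Camera) : Matrix (Fin 4) (Fin m) (LineRing m) :=
  Matrix.of fun r j => ∑ i : Fin 3, MvPolynomial.C (𝒞 j i r) * MvPolynomial.X (i, j)

/-- The ideal `I_𝒞 ⊆ R` generated by the 3×3 minors of `M(ℓ)`. -/
def minorsIdeal {m : ℕ} (𝒞 : Fin m → Camera) : Ideal (LineRing m) :=
  Ideal.span {p | ∃ (ri : Fin 3 → Fin 4) (ci : Fin 3 → Fin m),
    Function.Injective ri ∧ Function.Injective ci ∧
      p = ((MmatPoly 𝒞).submatrix ri ci).det}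

namespace LineMultiview

section PrincipalRadical

attribute [local instance] MvPolynomial.gradedAlgebra

variable {σ : Type*}

/-- If `x` has degree one and is a nonzerodivisor modulo the radical of a homogeneous ideal `P`,
then `P` is radical as soon as `P + (x)` is. -/
theorem isRadical_of_sup_span (P : Ideal (MvPolynomial σ ℂ)) (x : MvPolynomial σ ℂ)
    (hx : x.IsHomogeneous 1) (hP : P.IsHomogeneous (homogeneousSubmodule σ ℂ))
    (hreg : ∀ g, g * x ∈ P.radical → g ∈ P.radical)
    (hrad : (P ⊔ Ideal.span {x}).IsRadical) : P.IsRadical := by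
  classical
  have key : ∀ n : ℕ, ∀ f ∈ P.radical, ∃ i ∈ P, ∃ r ∈ P.radical, f = i + x ^ n * r := by
    intro n
    induction n with
    | zero => exact fun f hf => ⟨0, P.zero_mem, f, hf, by simp⟩
    | succ n ih =>
      intro f hf
      obtain ⟨i, hi, r, hr, rfl⟩ := ih f hf
      have h1 : r ∈ P ⊔ Ideal.span {x} :=
        hrad (Ideal.radical_mono le_sup_left hr)
      obtain ⟨i', hi', y, hy, rfl⟩ := Submodule.mem_sup.1 h1
      obtain ⟨s, rfl⟩ := Ideal.mem_span_singleton'.1 hy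
      refine ⟨i + x ^ n * i', P.add_mem hi (P.mul_mem_left _ hi'), s, hreg s ?_, by ring⟩
      simpa using P.radical.sub_mem hr (Ideal.le_radical hi')
  intro f hf
  rw [← DirectSum.sum_support_decompose (homogeneousSubmodule σ ℂ) f]
  refine Ideal.sum_mem _ fun d _ => ?_
  obtain ⟨i, hi, r, -, rfl⟩ := key (d + 1) f hf
  have hxd : x ^ (d + 1) ∈ homogeneousSubmodule σ ℂ (d + 1) := by
    simpa using hx.pow (d + 1)
  rw [DirectSum.decompose_add, DirectSum.add_apply, Submodule.coe_add,
    DirectSum.coe_decompose_mul_of_left_mem_of_not_le _ hxd (by omega), add_zero]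
  exact hP d hi

/-- If `I ≤ P`, `x P ≤ I` and `x` is a nonzerodivisor modulo the radical ideal `P`,
then `I` is radical as soon as `I + (x)` is. -/
theorem isRadical_of_mul_mem {R : Type*} [CommRing R] (I P : Ideal R) (x : R)
    (hIP : I ≤ P) (hxP : ∀ p ∈ P, x * p ∈ I)
    (hreg : ∀ g, g * x ∈ P.radical → g ∈ P.radical) (hP : P.IsRadical)
    (hrad : (I ⊔ Ideal.span {x}).IsRadical) : I.IsRadical := by
  intro f hf
  obtain ⟨i, hi, y, hy, rfl⟩ := Submodule.mem_sup.1 (hrad (Ideal.radical_mono le_sup_left hf))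
  obtain ⟨s, rfl⟩ := Ideal.mem_span_singleton'.1 hy
  refine I.add_mem hi ?_
  rw [mul_comm]
  refine hxP _ (hP (hreg s ?_))
  have := Ideal.radical_mono hIP (I.radical.sub_mem hf (Ideal.le_radical hi))
  simpa using this

/-- A vector space over an infinite field is not covered by finitely many proper subspaces. -/
theorem exists_mem_forall_notMem {E : Type*} [AddCommGroup E] [Module ℂ E]
    (M : Submodule ℂ E) (B : Set (Submodule ℂ E)) (hfin : B.Finite)
    (hB : ∀ b ∈ B, ¬ M ≤ b) : ∃ x ∈ M, ∀ b ∈ B, x ∉ b := by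
  classical
  have h := Subspace.biUnion_ne_univ_of_top_notMem (k := ℂ) (E := M)
    (s := hfin.toFinset.image fun b => b.comap M.subtype) (by
      simp only [Finset.mem_image, Set.Finite.mem_toFinset, not_exists, not_and]
      intro b hb h
      refine hB b hb fun x hx => ?_
      have : (⟨x, hx⟩ : M) ∈ b.comap M.subtype := h ▸ Submodule.mem_top
      simpa using this)
  obtain ⟨x, hx⟩ := (Set.ne_univ_iff_exists_notMem _).1 h
  refine ⟨x, x.2, fun b hb hxb => hx ?_⟩
  simp only [Set.mem_iUnion]
  exact ⟨b.comap M.subtype, Finset.mem_image.2 ⟨b, hfin.mem_toFinset.2 hb, rfl⟩, by simpa using hxb⟩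

/-- Prime avoidance for a linear system `M` of elements: a generic member is a nonzerodivisor
modulo the radical of `P` if the elements of `M` have no common annihilator modulo `P.radical`. -/
theorem exists_regular_mem {R : Type*} [CommRing R] [IsNoetherianRing R] [Algebra ℂ R]
    {E : Type*} [AddCommGroup E] [Module ℂ E]
    (P : Ideal R) (φ : E →ₗ[ℂ] R) (M : Submodule ℂ E)
    (hM : ∀ g, (∀ μ ∈ M, g * φ μ ∈ P.radical) → g ∈ P.radical)
    (B : Set (Submodule ℂ E)) (hfin : B.Finite) (hB : ∀ b ∈ B, ¬ M ≤ b) :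
    ∃ μ ∈ M, (∀ b ∈ B, μ ∉ b) ∧ ∀ g, g * φ μ ∈ P.radical → g ∈ P.radical := by
  classical
  have hminfin := Ideal.finite_minimalPrimes_of_isNoetherianRing R P
  let ψ : Ideal R → Submodule ℂ E := fun p => (p.restrictScalars ℂ).comap φ
  obtain ⟨μ, hμM, hμ⟩ := exists_mem_forall_notMem M (B ∪ ψ '' P.minimalPrimes)
    (hfin.union (hminfin.image ψ)) (by
      rintro b (hb | ⟨p, hp, rfl⟩)
      · exact hB b hb
      · intro hle
        have hpp : p.IsPrime := hp.1.1
        have hex : ∃ g ∈ (hminfin.toFinset.erase p).inf id, g ∉ p := by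
          by_contra! hcon
          obtain ⟨q, hq, hqp⟩ := hpp.inf_le'.1 (show (hminfin.toFinset.erase p).inf id ≤ p from hcon)
          rw [Finset.mem_erase, Set.Finite.mem_toFinset] at hq
          exact hq.1 (le_antisymm hqp (hp.2 hq.2.1 hqp))
        obtain ⟨g, hg, hgp⟩ := hex
        refine hgp ?_
        have h1 : g ∈ P.radical := by
          refine hM g fun μ hμ => ?_
          rw [← Ideal.sInf_minimalPrimes, Submodule.mem_sInf]
          intro q hq
          by_cases hqp : q = p
          · subst hqp
            exact Ideal.mul_mem_left q _ (hle hμ)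
          · refine Ideal.mul_mem_right _ q ?_
            have : (hminfin.toFinset.erase p).inf id ≤ id q :=
              Finset.inf_le (Finset.mem_erase.2 ⟨hqp, hminfin.mem_toFinset.2 hq⟩)
            exact this hg
        exact (hpp.radical_le_iff.2 hp.1.2) h1)
  refine ⟨μ, hμM, fun b hb => hμ b (Or.inl hb), fun g hg => ?_⟩
  rw [← Ideal.sInf_minimalPrimes, Submodule.mem_sInf] at hg ⊢
  intro p hp
  exact ((hp.1.1.mem_or_mem (hg p hp)).resolve_right
    (hμ _ (Or.inr ⟨p, hp, rfl⟩)))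

end PrincipalRadical

section Annihilator

open Module

/-- The subspace of points on which all linear forms in `K` vanish. -/
def ann (K : Submodule ℂ Vec4) : Submodule ℂ Vec4 :=
  LinearMap.BilinForm.orthogonal (dotProductBilin ℂ ℂ) K

theorem mem_ann {K : Submodule ℂ Vec4} {v : Vec4} : v ∈ ann K ↔ ∀ p ∈ K, p ⬝ᵥ v = 0 := by
  simp [ann, LinearMap.BilinForm.mem_orthogonal_iff]

theorem dotForm_nondegenerate :
    LinearMap.BilinForm.Nondegenerate (dotProductBilin ℂ ℂ : LinearMap.BilinForm ℂ Vec4) := by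
  refine ⟨fun v hv => ?_, fun v hv => ?_⟩
  · exact dotProduct_eq_zero v fun w => by simpa using hv w
  · exact dotProduct_eq_zero v fun w => by simpa [dotProduct_comm] using hv w

theorem dotForm_isRefl :
    LinearMap.BilinForm.IsRefl (dotProductBilin ℂ ℂ : LinearMap.BilinForm ℂ Vec4) :=
  fun v w h => by simpa [dotProduct_comm] using h

theorem finrank_ann_add (K : Submodule ℂ Vec4) : finrank ℂ (ann K) + finrank ℂ K = 4 := by
  have h1 : finrank ℂ (ann K) = finrank ℂ Vec4 - finrank ℂ K :=
    LinearMap.BilinForm.finrank_orthogonal dotForm_nondegenerate K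
  have h2 : finrank ℂ K ≤ finrank ℂ Vec4 := Submodule.finrank_le K
  have h3 : finrank ℂ Vec4 = 4 := by simp
  omega

theorem ann_ann (K : Submodule ℂ Vec4) : ann (ann K) = K :=
  LinearMap.BilinForm.orthogonal_orthogonal dotForm_nondegenerate dotForm_isRefl K

theorem ann_anti {K L : Submodule ℂ Vec4} (h : K ≤ L) : ann L ≤ ann K :=
  fun _ hv => mem_ann.2 fun p hp => mem_ann.1 hv p (h hp)

theorem ann_le_ann_iff {K L : Submodule ℂ Vec4} : ann L ≤ ann K ↔ K ≤ L :=
  ⟨fun h => by simpa only [ann_ann] using ann_anti h, ann_anti⟩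

theorem ann_sup (K L : Submodule ℂ Vec4) : ann (K ⊔ L) = ann K ⊓ ann L := by
  refine le_antisymm (le_inf (ann_anti le_sup_left) (ann_anti le_sup_right)) fun v hv => ?_
  rw [mem_ann]
  intro p hp
  obtain ⟨a, ha, b, hb, rfl⟩ := Submodule.mem_sup.1 hp
  rw [add_dotProduct, mem_ann.1 hv.1 a ha, mem_ann.1 hv.2 b hb, add_zero]

theorem ann_inf (K L : Submodule ℂ Vec4) : ann (K ⊓ L) = ann K ⊔ ann L := by
  rw [← ann_ann (ann K ⊔ ann L), ann_sup, ann_ann, ann_ann]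

theorem mem_ann_span_singleton {c v : Vec4} : v ∈ ann (ℂ ∙ c) ↔ c ⬝ᵥ v = 0 := by
  refine ⟨fun h => mem_ann.1 h c (Submodule.mem_span_singleton_self c), fun h => mem_ann.2 ?_⟩
  intro p hp
  obtain ⟨a, rfl⟩ := Submodule.mem_span_singleton.1 hp
  rw [smul_dotProduct, h, smul_zero]

theorem finrank_sup_span_singleton {K : Submodule ℂ Vec4} {p : Vec4} (hp : p ∉ K) :
    finrank ℂ ↥(K ⊔ ℂ ∙ p) = finrank ℂ K + 1 := by
  have h0 : p ≠ 0 := fun h => hp (h ▸ K.zero_mem)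
  have h := Submodule.finrank_sup_add_finrank_inf_eq K (ℂ ∙ p)
  have h1 : K ⊓ ℂ ∙ p = ⊥ := by
    rw [eq_bot_iff]
    rintro x ⟨hxK, hx⟩
    obtain ⟨a, rfl⟩ := Submodule.mem_span_singleton.1 hx
    by_cases ha : a = 0
    · simp [ha]
    · exact absurd ((K.smul_mem_iff ha).1 hxK) hp
  rw [h1, finrank_bot, finrank_span_singleton h0] at h
  omega

/-- Two subspaces of `H` whose dimensions add up to more than that of `H` meet. -/
theorem exists_ne_zero_mem_inf {K L H : Submodule ℂ Vec4} (hK : K ≤ H) (hL : L ≤ H)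
    (h : finrank ℂ H < finrank ℂ K + finrank ℂ L) : ∃ u ∈ K, u ∈ L ∧ u ≠ 0 := by
  have h1 := Submodule.finrank_sup_add_finrank_inf_eq K L
  have h2 := Submodule.finrank_mono (sup_le hK hL)
  have h3 : K ⊓ L ≠ ⊥ := by
    intro h0
    rw [h0, finrank_bot] at h1
    omega
  obtain ⟨u, hu, hu0⟩ := Submodule.exists_mem_ne_zero_of_ne_bot h3
  exact ⟨u, hu.1, hu.2, hu0⟩

theorem exists_span_singleton_of_finrank_le_one {L : Submodule ℂ Vec4} (h : finrank ℂ L ≤ 1) :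
    ∃ a ∈ L, L = ℂ ∙ a := by
  obtain ⟨⟨a, ha⟩, h⟩ := finrank_le_one_iff.1 h
  refine ⟨a, ha, le_antisymm (fun x hx => ?_) ((Submodule.span_singleton_le_iff_mem _ _).2 ha)⟩
  obtain ⟨c, hc⟩ := h ⟨x, hx⟩
  exact Submodule.mem_span_singleton.2 ⟨c, by simpa using congrArg Subtype.val hc⟩

theorem exists_span_pair_of_finrank_le_two {L : Submodule ℂ Vec4} (h : finrank ℂ L ≤ 2) :
    ∃ a ∈ L, ∃ b ∈ L, L = Submodule.span ℂ {a, b} := by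
  by_cases hL : L = ⊥
  · exact ⟨0, L.zero_mem, 0, L.zero_mem, by simp [hL]⟩
  obtain ⟨a, ha, ha0⟩ := Submodule.exists_mem_ne_zero_of_ne_bot hL
  obtain ⟨Q, hQ⟩ := Submodule.exists_isCompl (ℂ ∙ a)
  have hsup : ℂ ∙ a ⊔ (L ⊓ Q) = L := by
    have := sup_inf_assoc_of_le Q ((Submodule.span_singleton_le_iff_mem a L).2 ha)
    rw [inf_comm, ← this, hQ.sup_eq_top, top_inf_eq]
  have h1 := Submodule.finrank_sup_add_finrank_inf_eq (ℂ ∙ a) (L ⊓ Q)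
  have h2 : ℂ ∙ a ⊓ (L ⊓ Q) = ⊥ := by
    rw [eq_bot_iff, ← hQ.inf_eq_bot]
    exact inf_le_inf_left _ inf_le_right
  rw [hsup, h2, finrank_bot, finrank_span_singleton ha0] at h1
  obtain ⟨b, hb, hLb⟩ := exists_span_singleton_of_finrank_le_one (L := L ⊓ Q) (by omega)
  refine ⟨a, ha, b, hb.1, ?_⟩
  rw [Submodule.span_insert, ← hLb, hsup]

end Annihilator

section RankIdeal

variable {m : ℕ}

/-- The coordinate ring of the space of `m`-tuples of vectors in `ℂ⁴`. -/
abbrev PtRing (m : ℕ) := MvPolynomial (Fin m × Fin 4) ℂ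

/-- The value of the linear form `p` on the `j`-th generic vector. -/
def lin (j : Fin m) : Vec4 →ₗ[ℂ] PtRing m :=
  Fintype.linearCombination ℂ fun r => X (j, r)

/-- The `2 × 2` minor of the linear forms `p, q` and the vectors `i, j`. -/
def det2 (p q : Vec4) (i j : Fin m) : PtRing m := lin i p * lin j q - lin j p * lin i q

/-- The `3 × 3` minor of the linear forms `p, q, r` and the vectors `i, j, k`. -/
def det3 (p q r : Vec4) (i j k : Fin m) : PtRing m :=
  lin i p * det2 q r j k - lin j p * det2 q r i k + lin k p * det2 q r i j

/-- The ideal of the `m`-tuples of vectors `v` such that `v j` is annihilated by `N j`, the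
restrictions of the `v j` to `K` have rank at most one, and those to `T` have rank at most two. -/
def rankIdeal (N : Fin m → Submodule ℂ Vec4) (K T : Submodule ℂ Vec4) : Ideal (PtRing m) :=
  Ideal.span ({f | ∃ j, ∃ p ∈ N j, f = lin j p} ∪
    ({f | ∃ p ∈ K, ∃ q ∈ K, ∃ i j, f = det2 p q i j} ∪
      {f | ∃ p ∈ T, ∃ q ∈ T, ∃ r ∈ T, ∃ i j k, f = det3 p q r i j k}))

/-- The `m`-tuples of vectors in the zero locus of `rankIdeal N K T`. -/
structure IsPoint (N : Fin m → Submodule ℂ Vec4) (K T : Submodule ℂ Vec4)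
    (V : Fin m → Vec4) : Prop where
  mem : ∀ j, V j ∈ ann (N j)
  rank_one : ∀ p ∈ K, ∀ q ∈ K, ∀ i j, (p ⬝ᵥ V i) * (q ⬝ᵥ V j) = (p ⬝ᵥ V j) * (q ⬝ᵥ V i)
  rank_two : ∀ p ∈ T, ∀ q ∈ T, ∀ r ∈ T, ∀ i j k,
    (p ⬝ᵥ V i) * ((q ⬝ᵥ V j) * (r ⬝ᵥ V k) - (q ⬝ᵥ V k) * (r ⬝ᵥ V j))
      - (p ⬝ᵥ V j) * ((q ⬝ᵥ V i) * (r ⬝ᵥ V k) - (q ⬝ᵥ V k) * (r ⬝ᵥ V i))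
      + (p ⬝ᵥ V k) * ((q ⬝ᵥ V i) * (r ⬝ᵥ V j) - (q ⬝ᵥ V j) * (r ⬝ᵥ V i)) = 0

/-- Evaluation at a tuple of vectors. -/
def evalAt (V : Fin m → Vec4) : PtRing m →+* ℂ := eval fun x => V x.1 x.2

theorem evalAt_lin (V : Fin m → Vec4) (j : Fin m) (p : Vec4) : evalAt V (lin j p) = p ⬝ᵥ V j := by
  simp [evalAt, lin, Fintype.linearCombination_apply, smul_eval, dotProduct]

theorem isHomogeneous_lin (j : Fin m) (p : Vec4) : (lin j p).IsHomogeneous 1 := by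
  rw [lin, Fintype.linearCombination_apply]
  refine IsHomogeneous.sum _ _ _ fun r _ => ?_
  rw [smul_eq_C_mul]
  simpa using (isHomogeneous_C _ (p r)).mul (isHomogeneous_X ℂ (j, r))

theorem isHomogeneous_det2 (p q : Vec4) (i j : Fin m) : (det2 p q i j).IsHomogeneous 2 :=
  ((isHomogeneous_lin i p).mul (isHomogeneous_lin j q)).sub
    ((isHomogeneous_lin j p).mul (isHomogeneous_lin i q))

theorem isHomogeneous_det3 (p q r : Vec4) (i j k : Fin m) : (det3 p q r i j k).IsHomogeneous 3 :=
  (((isHomogeneous_lin i p).mul (isHomogeneous_det2 q r j k)).sub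
    ((isHomogeneous_lin j p).mul (isHomogeneous_det2 q r i k))).add
      ((isHomogeneous_lin k p).mul (isHomogeneous_det2 q r i j))

variable {N N' : Fin m → Submodule ℂ Vec4} {K K' T T' : Submodule ℂ Vec4}

theorem lin_mem {j : Fin m} {p : Vec4} (hp : p ∈ N j) : lin j p ∈ rankIdeal N K T :=
  Ideal.subset_span (Or.inl ⟨j, p, hp, rfl⟩)

theorem det2_mem {p q : Vec4} (hp : p ∈ K) (hq : q ∈ K) (i j : Fin m) :
    det2 p q i j ∈ rankIdeal N K T :=
  Ideal.subset_span (Or.inr (Or.inl ⟨p, hp, q, hq, i, j, rfl⟩))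

theorem det3_mem {p q r : Vec4} (hp : p ∈ T) (hq : q ∈ T) (hr : r ∈ T) (i j k : Fin m) :
    det3 p q r i j k ∈ rankIdeal N K T :=
  Ideal.subset_span (Or.inr (Or.inr ⟨p, hp, q, hq, r, hr, i, j, k, rfl⟩))

theorem rankIdeal_le {I : Ideal (PtRing m)} (h1 : ∀ j, ∀ p ∈ N j, lin j p ∈ I)
    (h2 : ∀ p ∈ K, ∀ q ∈ K, ∀ i j, det2 p q i j ∈ I)
    (h3 : ∀ p ∈ T, ∀ q ∈ T, ∀ r ∈ T, ∀ i j k, det3 p q r i j k ∈ I) :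
    rankIdeal N K T ≤ I := by
  refine Ideal.span_le.2 ?_
  rintro f (⟨j, p, hp, rfl⟩ | ⟨p, hp, q, hq, i, j, rfl⟩ | ⟨p, hp, q, hq, r, hr, i, j, k, rfl⟩)
  exacts [h1 j p hp, h2 p hp q hq i j, h3 p hp q hq r hr i j k]

theorem rankIdeal_mono (hN : N ≤ N') (hK : K ≤ K') (hT : T ≤ T') :
    rankIdeal N K T ≤ rankIdeal N' K' T' :=
  rankIdeal_le (fun j _ hp => lin_mem (hN j hp))
    (fun _ hp _ hq => det2_mem (hK hp) (hK hq))
    (fun _ hp _ hq _ hr => det3_mem (hT hp) (hT hq) (hT hr))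

attribute [local instance] MvPolynomial.gradedAlgebra in
theorem isHomogeneous_rankIdeal :
    (rankIdeal N K T).IsHomogeneous (homogeneousSubmodule (Fin m × Fin 4) ℂ) := by
  refine Ideal.homogeneous_span _ _ ?_
  rintro f (⟨j, p, -, rfl⟩ | ⟨p, -, q, -, i, j, rfl⟩ | ⟨p, -, q, -, r, -, i, j, k, rfl⟩)
  exacts [⟨1, isHomogeneous_lin _ _⟩, ⟨2, isHomogeneous_det2 _ _ _ _⟩,
    ⟨3, isHomogeneous_det3 _ _ _ _ _ _⟩]

theorem rankIdeal_sup_span (n : Fin m) (μ : Vec4) :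
    rankIdeal N K T ⊔ Ideal.span {lin n μ} =
      rankIdeal (Function.update N n (N n ⊔ ℂ ∙ μ)) K T := by
  refine le_antisymm (sup_le ?_ ?_) (rankIdeal_le ?_ ?_ ?_)
  · refine rankIdeal_mono (fun j => ?_) le_rfl le_rfl
    by_cases h : j = n
    · subst h; simp
    · simp [h]
  · rw [Ideal.span_singleton_le_iff_mem]
    refine lin_mem ?_
    rw [Function.update_self]
    exact Submodule.mem_sup_right (Submodule.mem_span_singleton_self μ)
  · intro j p hp
    by_cases h : j = n
    · subst h
      rw [Function.update_self] at hp
      obtain ⟨a, ha, b, hb, rfl⟩ := Submodule.mem_sup.1 hp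
      obtain ⟨s, rfl⟩ := Submodule.mem_span_singleton.1 hb
      rw [map_add, map_smul]
      refine Ideal.add_mem _ (Ideal.mem_sup_left (lin_mem ha)) (Ideal.mem_sup_right ?_)
      rw [smul_eq_C_mul]
      exact Ideal.mul_mem_left _ _ (Ideal.mem_span_singleton_self _)
    · rw [Function.update_of_ne h] at hp
      exact Ideal.mem_sup_left (lin_mem hp)
  · exact fun p hp q hq i j => Ideal.mem_sup_left (det2_mem hp hq i j)
  · exact fun p hp q hq r hr i j k => Ideal.mem_sup_left (det3_mem hp hq hr i j k)

theorem mem_radical_rankIdeal {f : PtRing m} :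
    f ∈ (rankIdeal N K T).radical ↔ ∀ V, IsPoint N K T V → evalAt V f = 0 := by
  rw [← vanishingIdeal_zeroLocus_eq_radical (K := ℂ), mem_vanishingIdeal_iff]
  constructor
  · intro h V hV
    have := h (fun x => V x.1 x.2) ?_
    · simpa [evalAt, aeval_eq_eval] using this
    rw [rankIdeal, zeroLocus_span]
    rintro g hg
    have : evalAt V g = 0 := by
      rcases hg with ⟨j, p, hp, rfl⟩ | ⟨p, hp, q, hq, i, j, rfl⟩ |
        ⟨p, hp, q, hq, r, hr, i, j, k, rfl⟩
      · rw [evalAt_lin]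
        exact mem_ann.1 (hV.mem j) p hp
      · simp only [det2, map_sub, map_mul, evalAt_lin]
        exact sub_eq_zero.2 (hV.rank_one p hp q hq i j)
      · simp only [det3, det2, map_sub, map_add, map_mul, evalAt_lin]
        exact hV.rank_two p hp q hq r hr i j k
    simpa [evalAt, aeval_eq_eval] using this
  · intro h x hx
    have hI : ∀ g ∈ rankIdeal N K T, evalAt (fun i r => x (i, r)) g = 0 := by
      intro g hg
      simpa [evalAt, aeval_eq_eval] using hx g hg
    have := h (fun i r => x (i, r)) ⟨?_, ?_, ?_⟩
    · simpa [evalAt, aeval_eq_eval] using this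
    · intro j
      refine mem_ann.2 fun p hp => ?_
      simpa only [evalAt_lin] using hI _ (lin_mem hp)
    · intro p hp q hq i j
      simpa only [det2, map_sub, map_mul, evalAt_lin, sub_eq_zero] using hI _ (det2_mem hp hq i j)
    · intro p hp q hq r hr i j k
      simpa only [det3, det2, map_sub, map_add, map_mul, evalAt_lin] using
        hI _ (det3_mem hp hq hr i j k)

theorem evalAt_eq_zero_of_curve (g : PtRing m) (V : ℂ → Fin m → Vec4) (hV : Continuous V)
    (h : ∀ᶠ ε in nhdsWithin 0 {0}ᶜ, evalAt (V ε) g = 0) : evalAt (V 0) g = 0 := by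
  have hc : Continuous fun ε => evalAt (V ε) g := by
    have h1 : Continuous fun ε => fun x : Fin m × Fin 4 => V ε x.1 x.2 := by fun_prop
    exact (MvPolynomial.continuous_eval g).comp h1
  have h1 := (hc.tendsto 0).mono_left (nhdsWithin_le_nhds (s := {0}ᶜ))
  exact tendsto_nhds_unique h1 ((Filter.tendsto_congr' h).2 tendsto_const_nhds)

theorem lin_mul_lin_mem {n : Fin m} {μ q : Vec4} (hμ : μ ∈ K) (hq : q ∈ N n) (hqK : q ∈ K)
    (a : Fin m) : lin n μ * lin a q ∈ rankIdeal N K T := by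
  have h : lin n μ * lin a q = det2 μ q n a + lin a μ * lin n q := by rw [det2]; ring
  rw [h]
  exact Ideal.add_mem _ (det2_mem hμ hqK n a) (Ideal.mul_mem_left _ _ (lin_mem hq))

theorem lin_mul_det2_mem {n : Fin m} {μ q r : Vec4} (hμ : μ ∈ T) (hq : q ∈ N n) (hqT : q ∈ T)
    (hr : r ∈ N n) (hrT : r ∈ T) (a b : Fin m) :
    lin n μ * det2 q r a b ∈ rankIdeal N K T := by
  have h : lin n μ * det2 q r a b = det3 μ q r n a b
      + (lin a μ * lin b r - lin b μ * lin a r) * lin n q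
      + (lin b μ * lin a q - lin a μ * lin b q) * lin n r := by
    rw [det3]; simp only [det2]; ring
  rw [h]
  exact Ideal.add_mem _ (Ideal.add_mem _ (det3_mem hμ hqT hrT n a b)
    (Ideal.mul_mem_left _ _ (lin_mem hq))) (Ideal.mul_mem_left _ _ (lin_mem hr))

/-- Rank at most one on a subspace of codimension one implies rank at most two. -/
theorem det3_mem_of_det2_mem {I : Ideal (PtRing m)} {p₀ : Vec4} (htop : K ⊔ ℂ ∙ p₀ = ⊤)
    (h : ∀ p ∈ K, ∀ q ∈ K, ∀ i j, det2 p q i j ∈ I) (p q r : Vec4) (i j k : Fin m) :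
    det3 p q r i j k ∈ I := by
  have hdec : ∀ x : Vec4, ∃ s : ℂ, ∃ y ∈ K, x = y + s • p₀ := by
    intro x
    have hx : x ∈ K ⊔ ℂ ∙ p₀ := htop ▸ Submodule.mem_top
    obtain ⟨y, hy, z, hz, rfl⟩ := Submodule.mem_sup.1 hx
    obtain ⟨s, rfl⟩ := Submodule.mem_span_singleton.1 hz
    exact ⟨s, y, hy, rfl⟩
  obtain ⟨s, p, hp, rfl⟩ := hdec p
  obtain ⟨t, q, hq, rfl⟩ := hdec q
  obtain ⟨u, r, hr, rfl⟩ := hdec r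
  have hexp : det3 (p + s • p₀) (q + t • p₀) (r + u • p₀) i j k =
      (lin i p + C s * lin i p₀) * det2 q r j k - (lin j p + C s * lin j p₀) * det2 q r i k
        + (lin k p + C s * lin k p₀) * det2 q r i j
      - C t * (lin i p₀ * det2 p r j k - lin j p₀ * det2 p r i k + lin k p₀ * det2 p r i j)
      + C u * (lin i p₀ * det2 p q j k - lin j p₀ * det2 p q i k + lin k p₀ * det2 p q i j) := by
    simp only [det3, det2, map_add, map_smul, smul_eq_C_mul]
    ring
  rw [hexp]
  have hm : ∀ {x y : Vec4} (z : PtRing m) (a b : Fin m), x ∈ K → y ∈ K → z * det2 x y a b ∈ I :=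
    fun z a b hx hy => Ideal.mul_mem_left _ _ (h _ hx _ hy a b)
  refine Ideal.add_mem _ (Ideal.sub_mem _ (Ideal.add_mem _ (Ideal.sub_mem _ ?_ ?_) ?_)
    (Ideal.mul_mem_left _ _ (Ideal.add_mem _ (Ideal.sub_mem _ ?_ ?_) ?_)))
    (Ideal.mul_mem_left _ _ (Ideal.add_mem _ (Ideal.sub_mem _ ?_ ?_) ?_)) <;>
  exact hm _ _ _ ‹_› ‹_›

end RankIdeal

section Points

open Module

variable {m : ℕ} {N N' : Fin m → Submodule ℂ Vec4} {K T : Submodule ℂ Vec4} {V : Fin m → Vec4}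

theorem ann_top : ann ⊤ = ⊥ := by
  have h := finrank_ann_add ⊤
  rw [finrank_top] at h
  simp only [finrank_fintype_fun_eq_card, Fintype.card_fin] at h
  exact Submodule.finrank_eq_zero.1 (by omega)

theorem ann_bot : ann ⊥ = ⊤ := by rw [← ann_top, ann_ann]

/-- Rank conditions hold for tuples in the span of two vectors, the first of which is
annihilated by `K`. -/
theorem IsPoint.of_mem_span_pair {a b : Vec4} (hmem : ∀ j, V j ∈ ann (N j)) (ha : a ∈ ann K)
    (hV : ∀ j, V j ∈ Submodule.span ℂ {a, b}) : IsPoint N K T V := by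
  simp only [Submodule.mem_span_pair] at hV
  choose s t h using hV
  obtain rfl : (fun j => s j • a + t j • b) = V := funext h
  refine ⟨hmem, fun p hp q hq i j => ?_, fun p _ q _ r _ i j k => ?_⟩
  · simp only [dotProduct_add, dotProduct_smul, mem_ann.1 ha p hp, mem_ann.1 ha q hq, smul_eq_mul]
    ring
  · simp only [dotProduct_add, dotProduct_smul, smul_eq_mul]
    ring

theorem IsPoint.finrank_span_le (hV : IsPoint N K ⊤ V) :
    finrank ℂ (Submodule.span ℂ (Set.range V)) ≤ 2 := by
  by_contra! h
  obtain ⟨f, hf, -, hli⟩ := Submodule.exists_fun_fin_finrank_span_eq ℂ (Set.range V)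
  choose idx hidx using hf
  have hli' := hli.comp _ (Fin.castLE_injective (Nat.succ_le_of_lt h))
  obtain ⟨G, hG⟩ := LinearMap.exists_leftInverse_of_injective
    (Fintype.linearCombination ℂ (f ∘ Fin.castLE (Nat.succ_le_of_lt h)))
    (LinearMap.ker_eq_bot.2 (linearIndependent_iff_injective_fintypeLinearCombination.1 hli'))
  have hdot : ∀ (x : Fin 3) (v : Vec4), (fun r => G (Pi.single r 1) x) ⬝ᵥ v = G v x := by
    intro x v
    conv_rhs => rw [← Finset.univ_sum_single v]
    simp only [dotProduct, map_sum, Finset.sum_apply]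
    refine Finset.sum_congr rfl fun r _ => ?_
    rw [← mul_one (v r), ← smul_eq_mul (v r), Pi.single_smul', map_smul]
    simp [mul_comm]
  have hδ : ∀ x y : Fin 3,
      G (V (idx (Fin.castLE (Nat.succ_le_of_lt h) y))) x = if x = y then 1 else 0 := by
    intro x y
    rw [hidx]
    have := congrFun (LinearMap.congr_fun hG (Pi.single y 1)) x
    simpa [Pi.single_apply, Fintype.linearCombination_apply] using this
  have h3 := hV.rank_two (fun r => G (Pi.single r 1) 0) trivial (fun r => G (Pi.single r 1) 1)
    trivial (fun r => G (Pi.single r 1) 2) trivial (idx (Fin.castLE (Nat.succ_le_of_lt h) 0))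
    (idx (Fin.castLE (Nat.succ_le_of_lt h) 1)) (idx (Fin.castLE (Nat.succ_le_of_lt h) 2))
  simp only [hdot, hδ] at h3
  simp at h3

theorem IsPoint.exists_span_pair (hV : IsPoint N K ⊤ V) :
    ∃ a ∈ ann K, ∃ b ∈ Submodule.span ℂ (Set.range V), ∀ j, V j ∈ Submodule.span ℂ {a, b} := by
  have hL := hV.finrank_span_le
  set L := Submodule.span ℂ (Set.range V)
  have hVL : ∀ j, V j ∈ L := fun j => Submodule.subset_span ⟨j, rfl⟩
  by_cases h : ∀ j, V j ∈ ann K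
  · obtain ⟨a, ha, b, hb, hab⟩ := exists_span_pair_of_finrank_le_two hL
    exact ⟨a, Submodule.span_le.2 (Set.range_subset_iff.2 h) ha, b, hb, fun j => hab ▸ hVL j⟩
  · push Not at h
    obtain ⟨i, hi⟩ := h
    have h1 : V i ∉ ann K ⊓ L := fun h => hi h.1
    have h2 := finrank_sup_span_singleton h1
    have h3 : ann K ⊓ L ⊔ ℂ ∙ V i ≤ L :=
      sup_le inf_le_right ((Submodule.span_singleton_le_iff_mem _ _).2 (hVL i))
    have h4 := Submodule.finrank_mono h3
    obtain ⟨a, ha, haL⟩ := exists_span_singleton_of_finrank_le_one (L := ann K ⊓ L) (by omega)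
    refine ⟨a, ha.1, V i, hVL i, fun j => ?_⟩
    rw [mem_ann] at hi
    push Not at hi
    obtain ⟨p, hp, hpi⟩ := hi
    have h5 : V j - ((p ⬝ᵥ V j) / (p ⬝ᵥ V i)) • V i ∈ ann K ⊓ L := by
      refine ⟨mem_ann.2 fun q hq => ?_, L.sub_mem (hVL j) (L.smul_mem _ (hVL i))⟩
      rw [dotProduct_sub, dotProduct_smul, smul_eq_mul]
      have := hV.rank_one p hp q hq i j
      field_simp
      linear_combination this
    rw [haL, Submodule.mem_span_singleton] at h5
    obtain ⟨s, hs⟩ := h5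
    exact Submodule.mem_span_pair.2 ⟨s, (p ⬝ᵥ V j) / (p ⬝ᵥ V i), by rw [hs]; simp⟩

/-- If the zero locus is the closure of the locus where the `n`-th vector is not annihilated
by `M`, then a generic member of `M` gives a regular linear form. -/
theorem exists_regular_of_dense (n : Fin m) (M : Submodule ℂ Vec4)
    (h : ∀ g : PtRing m, (∀ V, IsPoint N K T V → V n ∉ ann M → evalAt V g = 0) →
      ∀ V, IsPoint N K T V → evalAt V g = 0)
    (B : Set (Submodule ℂ Vec4)) (hfin : B.Finite) (hB : ∀ b ∈ B, ¬ M ≤ b) :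
    ∃ μ ∈ M, (∀ b ∈ B, μ ∉ b) ∧
      ∀ g, g * lin n μ ∈ (rankIdeal N K T).radical → g ∈ (rankIdeal N K T).radical := by
  refine exists_regular_mem _ (lin n) M (fun g hg => ?_) B hfin hB
  rw [mem_radical_rankIdeal]
  refine h g fun V hV hn => ?_
  rw [mem_ann] at hn
  push Not at hn
  obtain ⟨μ, hμ, hne⟩ := hn
  have := mem_radical_rankIdeal.1 (hg μ hμ) V hV
  rw [map_mul, evalAt_lin] at this
  exact (mul_eq_zero.1 this).resolve_right hne

theorem exists_regular_of_translate (n : Fin m) (M : Submodule ℂ Vec4)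
    (h : ∀ V, IsPoint N K T V → ∃ u, u ∉ ann M ∧
      ∀ ε : ℂ, IsPoint N K T (Function.update V n (V n + ε • u)))
    (B : Set (Submodule ℂ Vec4)) (hfin : B.Finite) (hB : ∀ b ∈ B, ¬ M ≤ b) :
    ∃ μ ∈ M, (∀ b ∈ B, μ ∉ b) ∧
      ∀ g, g * lin n μ ∈ (rankIdeal N K T).radical → g ∈ (rankIdeal N K T).radical := by
  refine exists_regular_of_dense n M (fun g hg V hV => ?_) B hfin hB
  by_cases hn : V n ∈ ann M
  · obtain ⟨u, hu, hpt⟩ := h V hV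
    have := evalAt_eq_zero_of_curve g (fun ε => Function.update V n (V n + ε • u))
      (by fun_prop) ?_
    · simpa using this
    · filter_upwards [self_mem_nhdsWithin] with ε hε
      refine hg _ (hpt ε) ?_
      rw [Function.update_self, Submodule.add_mem_iff_right _ hn, Submodule.smul_mem_iff _ hε]
      exact hu
  · exact hg V hV hn

theorem IsPoint.update_of_rank_one (hV : IsPoint N K ⊥ V) {n : Fin m} {u : Vec4}
    (hu : u ∈ ann (N n))
    (h : ∀ p ∈ K, ∀ q ∈ K, ∀ j, (p ⬝ᵥ u) * (q ⬝ᵥ V j) = (p ⬝ᵥ V j) * (q ⬝ᵥ u)) (ε : ℂ) :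
    IsPoint N K ⊥ (Function.update V n (V n + ε • u)) := by
  refine ⟨fun j => ?_, fun p hp q hq i j => ?_, fun p hp q hq r hr i j k => ?_⟩
  · by_cases hj : j = n
    · subst hj
      rw [Function.update_self]
      exact add_mem (hV.mem j) (Submodule.smul_mem _ _ hu)
    · rw [Function.update_of_ne hj]
      exact hV.mem j
  · have h1 := hV.rank_one p hp q hq i j
    have h2 := h p hp q hq i
    have h3 := h p hp q hq j
    by_cases hi : i = n <;> by_cases hj : j = n
    · rw [hi, hj]
    · subst hi
      simp only [Function.update_self, Function.update_of_ne hj, dotProduct_add, dotProduct_smul,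
        smul_eq_mul]
      linear_combination h1 + ε * h3
    · subst hj
      simp only [Function.update_self, Function.update_of_ne hi, dotProduct_add, dotProduct_smul,
        smul_eq_mul]
      linear_combination h1 - ε * h2
    · simpa only [Function.update_of_ne hi, Function.update_of_ne hj] using h1
  · simp [(Submodule.mem_bot ℂ).1 hp]

theorem IsPoint.update_of_span_pair (hV : IsPoint N K T V) {n : Fin m} {a b u : Vec4}
    (ha : a ∈ ann K) (hab : ∀ j, V j ∈ Submodule.span ℂ {a, b}) (hu : u ∈ ann (N n))
    (huab : u ∈ Submodule.span ℂ {a, b}) (ε : ℂ) :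
    IsPoint N K T (Function.update V n (V n + ε • u)) := by
  refine IsPoint.of_mem_span_pair (b := b) (fun j => ?_) ha fun j => ?_ <;> by_cases hj : j = n
  · subst hj
    rw [Function.update_self]
    exact add_mem (hV.mem j) (Submodule.smul_mem _ _ hu)
  · rw [Function.update_of_ne hj]
    exact hV.mem j
  · subst hj
    rw [Function.update_self]
    exact add_mem (hab j) (Submodule.smul_mem _ _ huab)
  · rw [Function.update_of_ne hj]
    exact hab j

theorem IsPoint.exists_translate {H : Submodule ℂ Vec4} {n : Fin m} (hV : IsPoint N ⊥ ⊤ V)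
    (hVH : ∀ j, V j ∈ H) (hNH : ann (N n) ≤ H) (h1 : 1 ≤ finrank ℂ (ann (N n)))
    (h2 : finrank ℂ H < finrank ℂ (ann (N n)) + 2) :
    ∃ u ≠ 0, ∀ ε : ℂ, IsPoint N ⊥ ⊤ (Function.update V n (V n + ε • u)) := by
  have hL := hV.finrank_span_le
  have hLH : Submodule.span ℂ (Set.range V) ≤ H := Submodule.span_le.2 (Set.range_subset_iff.2 hVH)
  set L := Submodule.span ℂ (Set.range V)
  have hVL : ∀ j, V j ∈ L := fun j => Submodule.subset_span ⟨j, rfl⟩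
  have hbot : ∀ a : Vec4, a ∈ ann ⊥ := fun a => by rw [ann_bot]; trivial
  by_cases h : finrank ℂ L ≤ 1
  · obtain ⟨a, -, ha⟩ := exists_span_singleton_of_finrank_le_one h
    obtain ⟨u, hu, hu0⟩ := Submodule.exists_mem_ne_zero_of_ne_bot
      (fun h => by rw [h, finrank_bot] at h1; omega : ann (N n) ≠ ⊥)
    refine ⟨u, hu0, hV.update_of_span_pair (a := a) (b := u) (hbot a) (fun j => ?_) hu
      (Submodule.subset_span (by simp))⟩
    exact Submodule.span_mono (by simp) (ha ▸ hVL j)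
  · obtain ⟨u, hu, huL, hu0⟩ := exists_ne_zero_mem_inf hNH hLH (by omega)
    obtain ⟨a, -, b, -, hab⟩ := exists_span_pair_of_finrank_le_two hL
    exact ⟨u, hu0, hV.update_of_span_pair (hbot a) (fun j => hab ▸ hVL j) hu (hab ▸ huL)⟩

end Points

section Radical

open Module

variable {m : ℕ} {N : Fin m → Submodule ℂ Vec4} {K T : Submodule ℂ Vec4}

theorem wellFoundedGT_family : WellFoundedGT (Fin m → Submodule ℂ Vec4) :=
  ⟨(Function.wellFoundedLT (ι := Fin m) (α := (Submodule ℂ Vec4)ᵒᵈ)).wf⟩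

theorem lt_update {n : Fin m} {A : Submodule ℂ Vec4} (h : N n < A) : N < Function.update N n A :=
  lt_update_self_iff.2 h

theorem lt_sup_span_singleton {A : Submodule ℂ Vec4} {μ : Vec4} (h : μ ∉ A) : A < A ⊔ ℂ ∙ μ :=
  left_lt_sup.2 fun hle => h (hle (Submodule.mem_span_singleton_self μ))

theorem lt_update_sup {n : Fin m} {μ : Vec4} (h : μ ∉ N n) :
    N < Function.update N n (N n ⊔ ℂ ∙ μ) :=
  lt_update (lt_sup_span_singleton h)

theorem mul_mem_of_mem_rankIdeal {I : Ideal (PtRing m)} {x : PtRing m}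
    (h1 : ∀ j, ∀ p ∈ N j, x * lin j p ∈ I)
    (h2 : ∀ p ∈ K, ∀ q ∈ K, ∀ i j, x * det2 p q i j ∈ I)
    (h3 : ∀ p ∈ T, ∀ q ∈ T, ∀ r ∈ T, ∀ i j k, x * det3 p q r i j k ∈ I) :
    ∀ f ∈ rankIdeal N K T, x * f ∈ I :=
  rankIdeal_le (I := Submodule.comap (LinearMap.mulLeft (PtRing m) x) I) h1 h2 h3

theorem det3_bot_mem (I : Ideal (PtRing m)) :
    ∀ p ∈ (⊥ : Submodule ℂ Vec4), ∀ q ∈ (⊥ : Submodule ℂ Vec4), ∀ r ∈ (⊥ : Submodule ℂ Vec4),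
      ∀ i j k : Fin m, det3 p q r i j k ∈ I := by
  intro p hp q _ r _ i j k
  simp [(Submodule.mem_bot ℂ).1 hp, det3]

theorem det2_bot_mem (I : Ideal (PtRing m)) :
    ∀ p ∈ (⊥ : Submodule ℂ Vec4), ∀ q ∈ (⊥ : Submodule ℂ Vec4),
      ∀ i j : Fin m, det2 p q i j ∈ I := by
  intro p hp q _ i j
  simp [(Submodule.mem_bot ℂ).1 hp, det2]

theorem isRadical_rankIdeal_of_forall_eq_top (h : ∀ j, N j = ⊤) : (rankIdeal N K T).IsRadical := by
  intro f hf
  have hX : ∀ x : Fin m × Fin 4, (X x : PtRing m) ∈ rankIdeal N K T := by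
    intro x
    have : lin x.1 (Pi.single x.2 1) = (X x : PtRing m) := by
      simp [lin]
    rw [← this]
    exact lin_mem (h x.1 ▸ Submodule.mem_top)
  have key : ∀ f : PtRing m, f - C (evalAt 0 f) ∈ rankIdeal N K T := by
    intro f
    induction f using MvPolynomial.induction_on with
    | C a => simp [evalAt]
    | add p q hp hq => simpa [add_sub_add_comm] using Ideal.add_mem _ hp hq
    | mul_X p x hp => simpa [evalAt] using Ideal.mul_mem_left _ p (hX x)
  have h0 := mem_radical_rankIdeal.1 hf 0 ⟨by simp, by simp, by simp⟩
  simpa [h0] using key f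

/-- Passing to a hyperplane section by a generic linear form in the `n`-th vector. -/
theorem isRadical_rankIdeal_of_update (n : Fin m) (M : Submodule ℂ Vec4)
    (h : ∀ V, IsPoint N K T V → ∃ u, u ∉ ann M ∧
      ∀ ε : ℂ, IsPoint N K T (Function.update V n (V n + ε • u)))
    (B : Set (Submodule ℂ Vec4)) (hfin : B.Finite) (hB : ∀ b ∈ B, ¬ M ≤ b)
    (hrad : ∀ μ ∈ M, (∀ b ∈ B, μ ∉ b) →
      (rankIdeal (Function.update N n (N n ⊔ ℂ ∙ μ)) K T).IsRadical) :
    (rankIdeal N K T).IsRadical := by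
  obtain ⟨μ, hμ, hμB, hreg⟩ := exists_regular_of_translate n M h B hfin hB
  refine isRadical_of_sup_span _ (lin n μ) (isHomogeneous_lin n μ) isHomogeneous_rankIdeal hreg ?_
  rw [rankIdeal_sup_span]
  exact hrad μ hμ hμB

theorem exists_mem_ann_ne_zero {A : Submodule ℂ Vec4} (h : A ≠ ⊤) : ∃ u ∈ ann A, u ≠ 0 := by
  refine Submodule.exists_mem_ne_zero_of_ne_bot fun h0 => h ?_
  rw [← ann_ann A, h0, ann_bot]

theorem notMem_ann_top {u : Vec4} (h : u ≠ 0) : u ∉ ann ⊤ := by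
  rw [ann_top]
  exact h

theorem isRadical_rankIdeal_bot_bot (N : Fin m → Submodule ℂ Vec4) :
    (rankIdeal N ⊥ ⊥).IsRadical := by
  induction N using wellFoundedGT_family.induction with
  | _ N ih =>
  by_cases hN : ∀ j, N j = ⊤
  · exact isRadical_rankIdeal_of_forall_eq_top hN
  push Not at hN
  obtain ⟨n, hn⟩ := hN
  refine isRadical_rankIdeal_of_update n ⊤ (fun V hV => ?_) {N n} (Set.finite_singleton _)
    (by simpa using hn) fun μ _ hμ => ih _ (lt_update_sup (hμ _ rfl))
  obtain ⟨u, hu, hu0⟩ := exists_mem_ann_ne_zero hn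
  refine ⟨u, notMem_ann_top hu0, hV.update_of_rank_one hu ?_⟩
  intro p hp q _ j
  simp [(Submodule.mem_bot ℂ).1 hp]

theorem IsPoint.exists_translate_of_rank_one {n : Fin m} {V : Fin m → Vec4}
    (hV : IsPoint (fun a => N a ⊔ (N n ⊓ K)) K ⊥ V) (hn : ¬ K ≤ N n) :
    ∃ u, u ∉ ann K ∧ ∀ ε : ℂ, IsPoint (fun a => N a ⊔ (N n ⊓ K)) K ⊥
      (Function.update V n (V n + ε • u)) := by
  have hnn : N n ⊔ (N n ⊓ K) = N n := sup_eq_left.2 inf_le_left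
  by_cases h : ∀ a, V a ∈ ann K
  · rw [← ann_le_ann_iff, SetLike.not_le_iff_exists] at hn
    obtain ⟨u, hu, huK⟩ := hn
    refine ⟨u, huK, hV.update_of_rank_one (hnn.symm ▸ hu) fun p hp q hq j => ?_⟩
    rw [mem_ann.1 (h j) p hp, mem_ann.1 (h j) q hq, mul_zero, zero_mul]
  · push Not at h
    obtain ⟨a, ha⟩ := h
    have h1 : V a ∈ ann (N n) ⊔ ann K := ann_inf _ _ ▸ ann_anti le_sup_right (hV.mem a)
    obtain ⟨u, hu, w, hw, huw⟩ := Submodule.mem_sup.1 h1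
    have hp : ∀ p ∈ K, p ⬝ᵥ V a = p ⬝ᵥ u := fun p hp => by
      rw [← huw, dotProduct_add, mem_ann.1 hw p hp, add_zero]
    refine ⟨u, fun huK => ha (huw ▸ add_mem huK hw),
      hV.update_of_rank_one (hnn.symm ▸ hu) fun p hpK q hqK j => ?_⟩
    rw [← hp p hpK, ← hp q hqK]
    exact hV.rank_one p hpK q hqK a j

/-- The rank one ideals are radical. -/
theorem isRadical_rankIdeal_bot (N : Fin m → Submodule ℂ Vec4) (K : Submodule ℂ Vec4) :
    (rankIdeal N K ⊥).IsRadical := by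
  induction N using wellFoundedGT_family.induction with
  | _ N ih =>
  by_cases hN : ∀ j, K ≤ N j
  · have h : rankIdeal N K ⊥ = rankIdeal N ⊥ ⊥ := by
      refine le_antisymm (rankIdeal_le (fun j p hp => lin_mem hp) (fun p hp q hq i j => ?_)
        (det3_bot_mem _)) (rankIdeal_mono le_rfl bot_le le_rfl)
      exact Ideal.sub_mem _ (Ideal.mul_mem_right _ _ (lin_mem (hN i hp)))
        (Ideal.mul_mem_right _ _ (lin_mem (hN j hp)))
    rw [h]
    exact isRadical_rankIdeal_bot_bot N
  push Not at hN
  obtain ⟨n, hn⟩ := hN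
  have hnn : N n ⊔ (N n ⊓ K) = N n := sup_eq_left.2 inf_le_left
  have hle : N ≤ fun a => N a ⊔ (N n ⊓ K) := fun a => le_sup_left
  obtain ⟨μ, hμ, hμn, hreg⟩ := exists_regular_of_translate n K
    (fun V hV => hV.exists_translate_of_rank_one hn) {N n} (Set.finite_singleton _) (by simpa)
  have hμn := hμn _ rfl
  refine isRadical_of_mul_mem _ _ (lin n μ) (rankIdeal_mono hle le_rfl le_rfl)
    (mul_mem_of_mem_rankIdeal (fun j p hp => ?_)
      (fun p hp q hq i j => Ideal.mul_mem_left _ _ (det2_mem hp hq i j))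
      fun p hp q hq r hr i j k => Ideal.mul_mem_left _ _ (det3_mem hp hq hr i j k)) hreg ?_ ?_
  · obtain ⟨a, ha, b, hb, rfl⟩ := Submodule.mem_sup.1 hp
    rw [map_add, mul_add]
    exact Ideal.add_mem _ (Ideal.mul_mem_left _ _ (lin_mem ha)) (lin_mul_lin_mem hμ hb.1 hb.2 j)
  · refine isRadical_of_sup_span _ (lin n μ) (isHomogeneous_lin n μ) isHomogeneous_rankIdeal hreg ?_
    rw [rankIdeal_sup_span]
    exact ih _ (hle.trans_lt (lt_update_sup (by rwa [hnn])))
  · rw [rankIdeal_sup_span]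
    exact ih _ (lt_update_sup hμn)

theorem sup_span_singleton_eq_top {A : Submodule ℂ Vec4} (h3 : finrank ℂ A = 3) {μ : Vec4}
    (hμ : μ ∉ A) : A ⊔ ℂ ∙ μ = ⊤ := by
  refine Submodule.eq_top_of_finrank_eq ?_
  rw [finrank_sup_span_singleton hμ, h3]
  simp

/-- If the `n`-th vector is confined to a line on which `K` vanishes, it may be dropped. -/
theorem isRadical_rankIdeal_of_finrank_eq_three {n : Fin m} (h3 : finrank ℂ (N n) = 3)
    (hK : K ≤ N n) (hrad : (rankIdeal (Function.update N n ⊤) K ⊤).IsRadical) :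
    (rankIdeal N K ⊤).IsRadical := by
  have hn : N n ≠ ⊤ := fun h => by rw [h, finrank_top] at h3; simp at h3
  obtain ⟨μ, -, hμn, hreg⟩ := exists_regular_of_translate (N := N) (K := N n) (T := ⊥) n ⊤ (by
    intro V hV
    obtain ⟨u, hu, hu0⟩ := exists_mem_ann_ne_zero hn
    refine ⟨u, notMem_ann_top hu0, hV.update_of_rank_one hu fun p hp q hq j => ?_⟩
    rw [mem_ann.1 hu p hp, mem_ann.1 hu q hq, mul_zero, zero_mul])
    {N n} (Set.finite_singleton _) (by simpa using hn)
  have htop := sup_span_singleton_eq_top h3 (hμn _ rfl)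
  refine isRadical_of_mul_mem _ _ (lin n μ) ?_ (mul_mem_of_mem_rankIdeal ?_ ?_ ?_) hreg
    (isRadical_rankIdeal_bot _ _) ?_
  · exact rankIdeal_le (fun j p hp => lin_mem hp) (fun p hp q hq i j => det2_mem (hK hp) (hK hq) i j)
      fun p _ q _ r _ i j k => det3_mem_of_det2_mem htop (fun p hp q hq => det2_mem hp hq) p q r i j k
  · exact fun j p hp => Ideal.mul_mem_left _ _ (lin_mem hp)
  · exact fun p hp q hq i j => 
    lin_mul_det2_mem Submodule.mem_top hp Submodule.mem_top hq Submodule.mem_top i j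
  · exact fun p hp q hq r hr i j k => Ideal.mul_mem_left _ _ (det3_bot_mem _ p hp q hq r hr i j k)
  · rwa [rankIdeal_sup_span, htop]

/-- The rank two ideal of a family of subspaces with a common nonzero vector is radical. -/
theorem isRadical_rankIdeal_bot_top {p : Vec4} (hp : p ≠ 0) (hN : ∀ j, p ∈ N j) :
    (rankIdeal N ⊥ ⊤).IsRadical := by
  induction N using wellFoundedGT_family.induction with
  | _ N ih =>
  by_cases hNtop : ∀ j, N j = ⊤
  · exact isRadical_rankIdeal_of_forall_eq_top hNtop
  push Not at hNtop
  obtain ⟨n, hn⟩ := hNtop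
  have hup : ∀ A, N n ≤ A → ∀ j, p ∈ Function.update N n A j := by
    intro A hA j
    by_cases hj : j = n
    · subst hj
      rw [Function.update_self]
      exact hA (hN j)
    · rw [Function.update_of_ne hj]
      exact hN j
  by_cases h3 : finrank ℂ (N n) = 3
  · exact isRadical_rankIdeal_of_finrank_eq_three h3 bot_le
      (ih _ (lt_update (lt_top_iff_ne_top.2 hn)) (hup _ le_top))
  have hfr : finrank ℂ (N n) < 4 := by
    have := Submodule.finrank_lt (lt_top_iff_ne_top.2 hn).ne
    simpa using this
  refine isRadical_rankIdeal_of_update n ⊤ (fun V hV => ?_) {N n} (Set.finite_singleton _)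
    (by simpa using hn) fun μ _ hμ => ih _ (lt_update_sup (hμ _ rfl)) (hup _ le_sup_left)
  have hH : ∀ j, ann (N j) ≤ ann (ℂ ∙ p) :=
    fun j => ann_anti ((Submodule.span_singleton_le_iff_mem _ _).2 (hN j))
  have e1 := finrank_ann_add (ℂ ∙ p)
  have e2 := finrank_ann_add (N n)
  rw [finrank_span_singleton hp] at e1
  obtain ⟨u, hu0, hu⟩ := hV.exists_translate (fun j => hH j (hV.mem j)) (hH n)
    (by omega) (by omega)
  exact ⟨u, notMem_ann_top hu0, hu⟩

end Radical

section Deformation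

open Module Filter Topology

variable {m : ℕ} {c : Fin m → Vec4} {S : Finset (Fin m)} {K H : Submodule ℂ Vec4} {n : Fin m}
  {V : Fin m → Vec4} {g : PtRing m} {a b : Vec4}

/-- Tuples of vectors supported on `S`, with `V j` orthogonal to `c j` for `j ∈ S`, lying in the
span of a vector annihilated by `K` and a vector of `H`. -/
structure IsPencil (c : Fin m → Vec4) (S : Finset (Fin m)) (K H : Submodule ℂ Vec4)
    (V : Fin m → Vec4) : Prop where
  off : ∀ j ∉ S, V j = 0
  on : ∀ j ∈ S, c j ⬝ᵥ V j = 0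
  pencil : ∃ a ∈ ann K, ∃ b ∈ H, ∀ j, V j ∈ Submodule.span ℂ {a, b}

/-- Deformation of a pencil obtained by moving the vector `a` in the direction `u`. -/
theorem IsPencil.evalAt_eq_zero_of_rotate (hV : IsPencil c S K H V) (hn : n ∈ S)
    (hg : ∀ V, IsPencil c S K H V → V n ∉ ann K → evalAt V g = 0) {u : Vec4}
    (hca : c n ⬝ᵥ a = 0) (hcb : c n ⬝ᵥ b ≠ 0) (hab : ∀ j, V j ∈ Submodule.span ℂ {a, b})
    (hpair : ∀ ε : ℂ, ∃ a' ∈ ann K, ∃ b' ∈ H,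
      a + ε • u ∈ Submodule.span ℂ {a', b'} ∧ b ∈ Submodule.span ℂ {a', b'})
    (hu : ∀ ε : ℂ, ε ≠ 0 → (c n ⬝ᵥ (a + ε • u)) • b - (c n ⬝ᵥ b) • (a + ε • u) ∉ ann K)
    (hexc : ∀ j ∈ S, j ≠ n → c j ⬝ᵥ a = 0 → c j ⬝ᵥ b = 0 → V j ∈ ℂ ∙ b) :
    evalAt V g = 0 := by
  have key : ∀ j, ∃ F : ℂ → Vec4, Continuous F ∧ F 0 = V j ∧
      (∀ ε, F ε ∈ Submodule.span ℂ {a + ε • u, b}) ∧ (j ∈ S → ∀ ε, c j ⬝ᵥ F ε = 0) ∧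
      (j ∉ S → ∀ ε, F ε = 0) ∧ (j = n → ∀ᶠ ε in 𝓝[≠] 0, F ε ∉ ann K) := by
    intro j
    have hF : ∀ ε : ℂ, (c j ⬝ᵥ (a + ε • u)) • b - (c j ⬝ᵥ b) • (a + ε • u) ∈
        Submodule.span ℂ {a + ε • u, b} := fun ε => sub_mem
      (Submodule.smul_mem _ _ (Submodule.subset_span (by simp)))
      (Submodule.smul_mem _ _ (Submodule.subset_span (by simp)))
    have hF0 : ∀ ε : ℂ, c j ⬝ᵥ ((c j ⬝ᵥ (a + ε • u)) • b - (c j ⬝ᵥ b) • (a + ε • u)) = 0 := by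
      intro ε
      simp only [dotProduct_sub, dotProduct_smul, smul_eq_mul]
      ring
    obtain ⟨s, t, hst⟩ := Submodule.mem_span_pair.1 (hab j)
    by_cases hj : j ∈ S
    swap
    · refine ⟨fun _ => 0, continuous_const, (hV.off j hj).symm, fun ε => zero_mem _,
        fun h => absurd h hj, fun _ _ => rfl, ?_⟩
      rintro rfl
      exact absurd hn hj
    have h0 := hV.on j hj
    rw [← hst, dotProduct_add, dotProduct_smul, dotProduct_smul, smul_eq_mul, smul_eq_mul] at h0
    by_cases hjn : j = n
    · subst hjn
      have ht : t = 0 := by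
        rw [hca, mul_zero, zero_add] at h0
        exact (mul_eq_zero.1 h0).resolve_right hcb
      refine ⟨fun ε => (-(s / (c j ⬝ᵥ b)) + ε) •
        ((c j ⬝ᵥ (a + ε • u)) • b - (c j ⬝ᵥ b) • (a + ε • u)), ?_, ?_,
        fun ε => Submodule.smul_mem _ _ (hF ε),
        fun _ ε => by rw [dotProduct_smul, hF0, smul_zero], fun h => absurd hj h, fun _ => ?_⟩
      · simp only [dotProduct_add, dotProduct_smul]
        fun_prop
      · rw [← hst, ht]
        simp only [zero_smul, add_zero, hca, zero_sub, ← neg_smul, smul_smul]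
        congr 1
        field_simp
      · have hne : ∀ᶠ ε in 𝓝[≠] (0 : ℂ), -(s / (c j ⬝ᵥ b)) + ε ≠ 0 := by
          by_cases hs : s / (c j ⬝ᵥ b) = 0
          · filter_upwards [self_mem_nhdsWithin] with ε hε
            simpa [hs] using hε
          · refine (eventually_ne_nhds (Ne.symm hs)).filter_mono nhdsWithin_le_nhds |>.mono ?_
            intro ε hε h
            exact hε (by linear_combination h)
        filter_upwards [hne, self_mem_nhdsWithin] with ε hε hε0
        rw [Submodule.smul_mem_iff _ hε]
        exact hu ε hε0
    · by_cases hz : c j ⬝ᵥ a = 0 ∧ c j ⬝ᵥ b = 0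
      · refine ⟨fun _ => V j, continuous_const, rfl, fun ε => ?_, fun _ _ => hV.on j hj,
          fun h => absurd hj h, fun h => absurd h hjn⟩
        exact Submodule.span_mono (by simp) (hexc j hj hjn hz.1 hz.2)
      · obtain ⟨τ, hτs, hτt⟩ : ∃ τ : ℂ, s = -τ * (c j ⬝ᵥ b) ∧ t = τ * (c j ⬝ᵥ a) := by
          by_cases hb0 : c j ⬝ᵥ b = 0
          · have ha0 : c j ⬝ᵥ a ≠ 0 := fun h => hz ⟨h, hb0⟩
            refine ⟨t / (c j ⬝ᵥ a), ?_, by field_simp⟩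
            rw [hb0, mul_zero, add_zero] at h0
            rw [(mul_eq_zero.1 h0).resolve_right ha0, hb0, mul_zero]
          · refine ⟨-(s / (c j ⬝ᵥ b)), by field_simp, ?_⟩
            field_simp
            linear_combination h0
        refine ⟨fun ε => τ • ((c j ⬝ᵥ (a + ε • u)) • b - (c j ⬝ᵥ b) • (a + ε • u)), ?_, ?_,
          fun ε => Submodule.smul_mem _ _ (hF ε),
          fun _ ε => by rw [dotProduct_smul, hF0, smul_zero], fun h => absurd hj h,
          fun h => absurd h hjn⟩
        · simp only [dotProduct_add, dotProduct_smul]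
          fun_prop
        · rw [← hst, hτs, hτt]
          simp only [zero_smul, add_zero, smul_sub, smul_smul]
          module
  choose F hFc hF0 hFmem hFon hFoff hFn using key
  have h0 := evalAt_eq_zero_of_curve g (fun ε j => F j ε) (continuous_pi hFc) ?_
  · simpa only [hF0] using h0
  · filter_upwards [hFn n rfl] with ε hε
    refine hg _ ⟨fun j hj => hFoff j hj ε, fun j hj => hFon j hj ε, ?_⟩ hε
    obtain ⟨a', ha', b', hb', h1, h2⟩ := hpair ε
    exact ⟨a', ha', b', hb', fun j => Submodule.span_le.2
      (Set.insert_subset_iff.2 ⟨h1, Set.singleton_subset_iff.2 h2⟩) (hFmem j ε)⟩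

theorem ann_eq_span_singleton {A : Submodule ℂ Vec4} (h3 : finrank ℂ A = 3) (ha : a ∈ ann A)
    (ha0 : a ≠ 0) : ann A = ℂ ∙ a := by
  have h := finrank_ann_add A
  refine (Submodule.eq_of_le_of_finrank_eq ((Submodule.span_singleton_le_iff_mem _ _).2 ha) ?_).symm
  rw [finrank_span_singleton ha0]
  omega

/-- A condition on the centers `c j` for `j ∈ S` relative to a two-dimensional space `K`. -/
structure IsAdmissible (c : Fin m → Vec4) (S : Finset (Fin m)) (K : Submodule ℂ Vec4) : Prop where
  finrank_eq : finrank ℂ K = 2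
  notMem : ∀ i ∈ S, c i ∉ K
  unique : ∀ i ∈ S, ∀ j ∈ S, ∀ k ∈ S, j ≠ i → k ≠ i → c j ∈ K ⊔ ℂ ∙ c i → c k ∈ K ⊔ ℂ ∙ c i → j = k

theorem IsAdmissible.finrank_sup (h : IsAdmissible c S K) {i : Fin m} (hi : i ∈ S) :
    finrank ℂ ↥(K ⊔ ℂ ∙ c i) = 3 := by
  rw [finrank_sup_span_singleton (h.notMem i hi), h.finrank_eq]

theorem IsAdmissible.ann_sup_eq (h : IsAdmissible c S K) {i : Fin m} (hi : i ∈ S)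
    (ha : a ∈ ann K) (ha0 : a ≠ 0) (hca : c i ⬝ᵥ a = 0) : ann (K ⊔ ℂ ∙ c i) = ℂ ∙ a :=
  ann_eq_span_singleton (h.finrank_sup hi) (ann_sup K _ ▸ ⟨ha, mem_ann_span_singleton.2 hca⟩) ha0

theorem IsAdmissible.exists_ne_zero (h : IsAdmissible c S K) {i : Fin m} (hi : i ∈ S) :
    ∃ b ∈ ann K, c i ⬝ᵥ b ≠ 0 := by
  by_contra! hcon
  refine h.notMem i hi ?_
  rw [← Submodule.span_singleton_le_iff_mem, ← ann_le_ann_iff]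
  exact fun v hv => mem_ann_span_singleton.2 (hcon v hv)

theorem IsAdmissible.mem_sup (h : IsAdmissible c S K) {i j : Fin m} (hi : i ∈ S)
    (ha : a ∈ ann K) (ha0 : a ≠ 0) (hca : c i ⬝ᵥ a = 0) (hja : c j ⬝ᵥ a = 0) :
    c j ∈ K ⊔ ℂ ∙ c i := by
  rw [← ann_ann (K ⊔ ℂ ∙ c i), h.ann_sup_eq hi ha ha0 hca, mem_ann_span_singleton,
    dotProduct_comm, hja]

theorem IsAdmissible.ann_le_span_pair (h : IsAdmissible c S K) {i : Fin m} (hi : i ∈ S)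
    (ha : a ∈ ann K) (ha0 : a ≠ 0) (hca : c i ⬝ᵥ a = 0) (hb : b ∈ ann K) (hcb : c i ⬝ᵥ b ≠ 0) :
    ann K ≤ Submodule.span ℂ {a, b} := by
  intro v hv
  have h1 : v - ((c i ⬝ᵥ v) / (c i ⬝ᵥ b)) • b ∈ ann (K ⊔ ℂ ∙ c i) := by
    rw [ann_sup]
    refine ⟨sub_mem hv (Submodule.smul_mem _ _ hb), mem_ann_span_singleton.2 ?_⟩
    rw [dotProduct_sub, dotProduct_smul, smul_eq_mul, div_mul_cancel₀ _ hcb, sub_self]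
  rw [h.ann_sup_eq hi ha ha0 hca] at h1
  obtain ⟨s, hs⟩ := Submodule.mem_span_singleton.1 h1
  exact Submodule.mem_span_pair.2 ⟨s, (c i ⬝ᵥ v) / (c i ⬝ᵥ b), by rw [hs]; simp⟩

theorem IsPencil.evalAt_eq_zero_of_pair (hV : IsPencil c S K H V) (hn : n ∈ S)
    (hK : IsAdmissible c S K) (hKH : ann K ≤ H) (hH : ¬ H ≤ ann K)
    (hg : ∀ V, IsPencil c S K H V → V n ∉ ann K → evalAt V g = 0)
    (ha : a ∈ ann K) (ha0 : a ≠ 0) (hb : b ∈ H) (hca : c n ⬝ᵥ a = 0) (hcb : c n ⬝ᵥ b ≠ 0)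
    (hab : ∀ j, V j ∈ Submodule.span ℂ {a, b}) : evalAt V g = 0 := by
  by_cases hbK : b ∈ ann K
  · obtain ⟨u, hu, huK⟩ := SetLike.not_le_iff_exists.1 hH
    refine hV.evalAt_eq_zero_of_rotate hn hg (u := u) hca hcb hab (fun ε => ?_) (fun ε hε h => ?_)
      fun j hj _ hja hjb => ?_
    · exact ⟨b, hbK, a + ε • u, add_mem (hKH ha) (Submodule.smul_mem _ _ hu),
        Submodule.subset_span (by simp), Submodule.subset_span (by simp)⟩
    · rw [Submodule.sub_mem_iff_right _ (Submodule.smul_mem _ _ hbK),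
        Submodule.smul_mem_iff _ hcb, Submodule.add_mem_iff_right _ ha,
        Submodule.smul_mem_iff _ hε] at h
      exact huK h
    · obtain ⟨v, hv, hjv⟩ := hK.exists_ne_zero hj
      obtain ⟨s, t, rfl⟩ :=
        Submodule.mem_span_pair.1 (hK.ann_le_span_pair hn ha ha0 hca hbK hcb hv)
      simp [hja, hjb] at hjv
  obtain ⟨u, hu, hcu⟩ := hK.exists_ne_zero hn
  have rot : ∀ V b, IsPencil c S K H V → b ∈ H → b ∉ ann K → c n ⬝ᵥ b ≠ 0 →
      (∀ j, V j ∈ Submodule.span ℂ {a, b}) →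
      (∀ j ∈ S, j ≠ n → c j ⬝ᵥ a = 0 → c j ⬝ᵥ b = 0 → V j ∈ ℂ ∙ b) → evalAt V g = 0 := by
    intro V b hV hb hbK hcb hab hexc
    refine hV.evalAt_eq_zero_of_rotate hn hg (u := u) hca hcb hab (fun ε => ?_) (fun ε hε h => ?_)
      hexc
    · exact ⟨a + ε • u, add_mem ha (Submodule.smul_mem _ _ hu), b, hb,
        Submodule.subset_span (by simp), Submodule.subset_span (by simp)⟩
    · rw [Submodule.sub_mem_iff_left _
        (Submodule.smul_mem _ _ (add_mem ha (Submodule.smul_mem _ _ hu))),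
        dotProduct_add, hca, zero_add, dotProduct_smul, smul_eq_mul,
        Submodule.smul_mem_iff _ (mul_ne_zero hε hcu)] at h
      exact hbK h
  by_cases hex : ∃ i ∈ S, i ≠ n ∧ c i ⬝ᵥ a = 0 ∧ c i ⬝ᵥ b = 0
  swap
  · exact rot V b hV hb hbK hcb hab fun j hj hjn h1 h2 => absurd ⟨j, hj, hjn, h1, h2⟩ hex
  obtain ⟨i, hi, hin, hia, hib⟩ := hex
  have hsupp : ∀ V, IsPencil c S K H V → (∀ j, V j ∈ Submodule.span ℂ {a, b}) →
      ∀ s t : ℂ, t ≠ 0 → s • a + t • b = V i → evalAt V g = 0 := by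
    intro V hV hab s t ht hst
    have hbV : b ∈ Submodule.span ℂ {a, V i} := by
      refine Submodule.mem_span_pair.2 ⟨-(s / t), t⁻¹, ?_⟩
      rw [← hst, smul_add, smul_smul, smul_smul, inv_mul_cancel₀ ht, one_smul, ← add_assoc,
        ← add_smul]
      have : -(s / t) + t⁻¹ * s = 0 := by field_simp; ring
      rw [this, zero_smul, zero_add]
    refine rot V (V i) hV ?_ ?_ ?_ (fun j => ?_) fun j hj hjn hja _ => ?_
    · exact hst ▸ add_mem (Submodule.smul_mem _ _ (hKH ha)) (Submodule.smul_mem _ _ hb)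
    · rw [← hst, Submodule.add_mem_iff_right _ (Submodule.smul_mem _ _ ha),
        Submodule.smul_mem_iff _ ht]
      exact hbK
    · rw [← hst, dotProduct_add, dotProduct_smul, hca, smul_zero, zero_add, dotProduct_smul]
      exact mul_ne_zero ht hcb
    · exact Submodule.span_le.2 (Set.insert_subset_iff.2 ⟨Submodule.subset_span (by simp),
        Set.singleton_subset_iff.2 hbV⟩) (hab j)
    · rw [hK.unique n hn j hj i hi hjn hin (hK.mem_sup hn ha ha0 hca hja)
        (hK.mem_sup hn ha ha0 hca hia)]
      exact Submodule.mem_span_singleton_self _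
  obtain ⟨s, t, hst⟩ := Submodule.mem_span_pair.1 (hab i)
  by_cases ht : t = 0
  swap
  · exact hsupp V hV hab s t ht hst
  have h0 := evalAt_eq_zero_of_curve g (fun δ => Function.update V i (V i + δ • b))
    (by fun_prop) ?_
  · simpa using h0
  filter_upwards [self_mem_nhdsWithin] with δ hδ
  have hab' : ∀ j, Function.update V i (V i + δ • b) j ∈ Submodule.span ℂ {a, b} := by
    intro j
    by_cases hji : j = i
    · subst hji
      rw [Function.update_self]
      exact add_mem (hab j) (Submodule.smul_mem _ _ (Submodule.subset_span (by simp)))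
    · rw [Function.update_of_ne hji]
      exact hab j
  refine hsupp _ ⟨fun j hj => ?_, fun j hj => ?_, a, ha, b, hb, hab'⟩ hab' s δ hδ ?_
  · rw [Function.update_of_ne (ne_of_mem_of_not_mem hi hj).symm]
    exact hV.off j hj
  · by_cases hji : j = i
    · subst hji
      rw [Function.update_self, dotProduct_add, hV.on j hj, dotProduct_smul, hib, smul_zero,
        add_zero]
    · rw [Function.update_of_ne hji]
      exact hV.on j hj
  · rw [Function.update_self, ← hst, ht, zero_smul, add_zero]

theorem IsPencil.evalAt_eq_zero_of_mem (hV : IsPencil c S K H V) (hn : n ∈ S)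
    (hg : ∀ V, IsPencil c S K H V → V n ∉ ann K → evalAt V g = 0)
    (ha : a ∈ ann K) (hb : b ∈ H) (hab : ∀ j, V j ∈ Submodule.span ℂ {a, b}) {u : Vec4}
    (hu : u ∈ Submodule.span ℂ {a, b}) (hcu : c n ⬝ᵥ u = 0) (huK : u ∉ ann K) :
    evalAt V g = 0 := by
  by_cases hVn : V n ∈ ann K
  swap
  · exact hg V hV hVn
  have h0 := evalAt_eq_zero_of_curve g (fun ε => Function.update V n (V n + ε • u))
    (by fun_prop) ?_
  · simpa using h0
  filter_upwards [self_mem_nhdsWithin] with ε hε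
  refine hg _ ⟨fun j hj => ?_, fun j hj => ?_, a, ha, b, hb, fun j => ?_⟩ ?_
  · rw [Function.update_of_ne (ne_of_mem_of_not_mem hn hj).symm]
    exact hV.off j hj
  · by_cases hj : j = n
    · subst hj
      rw [Function.update_self, dotProduct_add, hV.on j hn, dotProduct_smul, hcu, smul_zero,
        add_zero]
    · rw [Function.update_of_ne hj]
      exact hV.on j ‹_›
  · by_cases hj : j = n
    · subst hj
      rw [Function.update_self]
      exact add_mem (hab j) (Submodule.smul_mem _ _ hu)
    · rw [Function.update_of_ne hj]
      exact hab j
  · rw [Function.update_self, Submodule.add_mem_iff_right _ hVn, Submodule.smul_mem_iff _ hε]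
    exact huK

/-- The pencils whose `n`-th vector is not annihilated by `K` are dense. -/
theorem IsPencil.evalAt_eq_zero (hV : IsPencil c S K H V) (hn : n ∈ S)
    (hK : IsAdmissible c S K) (hKH : ann K ≤ H) (hH : ¬ H ≤ ann K)
    (hg : ∀ V, IsPencil c S K H V → V n ∉ ann K → evalAt V g = 0) : evalAt V g = 0 := by
  obtain ⟨a, ha, b, hb, hab⟩ := hV.pencil
  obtain ⟨w, hw, hcw⟩ := hK.exists_ne_zero hn
  by_cases hbK : b ∈ ann K
  · obtain ⟨a₀, ha₀, ha₀0⟩ := exists_mem_ann_ne_zero (A := K ⊔ ℂ ∙ c n) (fun h => by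
      have := hK.finrank_sup hn
      rw [h, finrank_top] at this
      simp at this)
    rw [ann_sup] at ha₀
    have hca₀ := mem_ann_span_singleton.1 ha₀.2
    refine hV.evalAt_eq_zero_of_pair hn hK hKH hH hg ha₀.1 ha₀0 (hKH hw) hca₀ hcw fun j => ?_
    exact hK.ann_le_span_pair hn ha₀.1 ha₀0 hca₀ hw hcw (Submodule.span_le.2
      (Set.insert_subset_iff.2 ⟨ha, Set.singleton_subset_iff.2 hbK⟩) (hab j))
  have hsolve : ∀ a ∈ ann K, c n ⬝ᵥ a ≠ 0 → (∀ j, V j ∈ Submodule.span ℂ {a, b}) →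
      evalAt V g = 0 := by
    intro a ha hca hab
    refine hV.evalAt_eq_zero_of_mem hn hg ha hb hab
      (u := -((c n ⬝ᵥ b) / (c n ⬝ᵥ a)) • a + (1 : ℂ) • b) (Submodule.mem_span_pair.2 ⟨_, _, rfl⟩)
      ?_ ?_
    · rw [dotProduct_add, dotProduct_smul, dotProduct_smul, smul_eq_mul, smul_eq_mul]
      field_simp
      ring
    · rw [Submodule.add_mem_iff_right _ (Submodule.smul_mem _ _ ha), one_smul]
      exact hbK
  by_cases hca : c n ⬝ᵥ a = 0
  swap
  · exact hsolve a ha hca hab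
  by_cases hcb : c n ⬝ᵥ b = 0
  · exact hV.evalAt_eq_zero_of_mem hn hg ha hb hab (Submodule.subset_span (by simp)) hcb hbK
  by_cases ha0 : a = 0
  · refine hsolve w hw hcw fun j => ?_
    have h := hab j
    rw [ha0, Submodule.span_insert_zero] at h
    exact Submodule.span_mono (by simp) h
  · exact hV.evalAt_eq_zero_of_pair hn hK hKH hH hg ha ha0 hb hca hcb hab

end Deformation

section MainInduction

open Module

variable {m : ℕ} {c : Fin m → Vec4} {S : Finset (Fin m)} {K : Submodule ℂ Vec4} {n : Fin m}
  {V : Fin m → Vec4}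

/-- The family imposing `c j ⬝ᵥ v j = 0` for `j ∈ S` and `v j = 0` for `j ∉ S`. -/
def centerFamily (c : Fin m → Vec4) (S : Finset (Fin m)) (j : Fin m) : Submodule ℂ Vec4 :=
  if j ∈ S then ℂ ∙ c j else ⊤

theorem centerFamily_of_mem (h : n ∈ S) : centerFamily c S n = ℂ ∙ c n := if_pos h

theorem update_centerFamily_top :
    Function.update (centerFamily c S) n ⊤ = centerFamily c (S.erase n) := by
  ext1 j
  by_cases hj : j = n
  · subst hj
    simp [centerFamily]
  · simp [centerFamily, hj]

theorem isPoint_iff_isPencil {A : Submodule ℂ Vec4} (hA : A ≤ K) :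
    IsPoint (fun j => centerFamily c S j ⊔ A) K ⊤ V ↔ IsPencil c S K (ann A) V := by
  constructor
  · intro hV
    have hVA : ∀ j, V j ∈ ann A := fun j => ann_anti le_sup_right (hV.mem j)
    refine ⟨fun j hj => ?_, fun j hj => ?_, ?_⟩
    · have := hV.mem j
      simpa [centerFamily, hj, ann_top] using this
    · have := ann_anti le_sup_left (hV.mem j)
      rwa [centerFamily_of_mem hj, mem_ann_span_singleton] at this
    · obtain ⟨a, ha, b, hb, hab⟩ := hV.exists_span_pair
      exact ⟨a, ha, b, Submodule.span_le.2 (Set.range_subset_iff.2 hVA) hb, hab⟩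
  · intro hV
    obtain ⟨a, ha, b, hb, hab⟩ := hV.pencil
    refine IsPoint.of_mem_span_pair (fun j => ?_) ha hab
    rw [ann_sup]
    refine ⟨?_, Submodule.span_le.2 (Set.insert_subset_iff.2
      ⟨ann_anti hA ha, Set.singleton_subset_iff.2 hb⟩) (hab j)⟩
    by_cases hj : j ∈ S
    · rw [centerFamily_of_mem hj]
      exact mem_ann_span_singleton.2 (hV.on j hj)
    · rw [hV.off j hj]
      exact zero_mem _

theorem IsAdmissible.mono {S' : Finset (Fin m)} (h : IsAdmissible c S K) (hS : S' ⊆ S) :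
    IsAdmissible c S' K :=
  ⟨h.finrank_eq, fun i hi => h.notMem i (hS hi),
    fun i hi j hj k hk => h.unique i (hS hi) j (hS hj) k (hS hk)⟩

theorem IsAdmissible.exists_regular (hK : IsAdmissible c S K) (hn : n ∈ S)
    {A : Submodule ℂ Vec4} (hA : A < K) (B : Set (Submodule ℂ Vec4)) (hfin : B.Finite)
    (hB : ∀ b ∈ B, ¬ K ≤ b) :
    ∃ μ ∈ K, (∀ b ∈ B, μ ∉ b) ∧
      ∀ g, g * lin n μ ∈ (rankIdeal (fun j => centerFamily c S j ⊔ A) K ⊤).radical →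
        g ∈ (rankIdeal (fun j => centerFamily c S j ⊔ A) K ⊤).radical := by
  refine exists_regular_of_dense n K (fun g hg V hV => ?_) B hfin hB
  simp only [isPoint_iff_isPencil hA.le] at hg hV
  exact hV.evalAt_eq_zero hn hK (ann_anti hA.le) (fun h => hA.not_ge (ann_le_ann_iff.1 h)) hg

theorem sup_span_singleton_eq_of_finrank_eq_two (hK : finrank ℂ K = 2) {μ ν : Vec4} (hμ : μ ∈ K)
    (hμ0 : μ ≠ 0) (hν : ν ∈ K) (hνμ : ν ∉ ℂ ∙ μ) : (ℂ ∙ μ) ⊔ (ℂ ∙ ν) = K := by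
  refine Submodule.eq_of_le_of_finrank_eq (sup_le ((Submodule.span_singleton_le_iff_mem _ _).2 hμ)
    ((Submodule.span_singleton_le_iff_mem _ _).2 hν)) ?_
  rw [finrank_sup_span_singleton hνμ, finrank_span_singleton hμ0, hK]

theorem rankIdeal_sup_eq {N : Fin m → Submodule ℂ Vec4} {μ ν : Vec4} (hN : ∀ j, μ ∈ N j)
    (hK : (ℂ ∙ μ) ⊔ (ℂ ∙ ν) = K) : rankIdeal N K ⊤ = rankIdeal N ⊥ ⊤ := by
  refine le_antisymm (rankIdeal_le (fun j p hp => lin_mem hp) (fun p hp q hq i j => ?_)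
    fun p hp q hq r hr => det3_mem hp hq hr) (rankIdeal_mono le_rfl bot_le le_rfl)
  have hdec : ∀ x ∈ K, ∃ s t : ℂ, s • μ + t • ν = x := by
    intro x hx
    rw [← hK, ← Submodule.span_insert] at hx
    exact Submodule.mem_span_pair.1 hx
  obtain ⟨s, t, rfl⟩ := hdec p hp
  obtain ⟨s', t', rfl⟩ := hdec q hq
  have h : det2 (s • μ + t • ν) (s' • μ + t' • ν) i j =
      (C s * C t' - C t * C s') * lin j ν * lin i μ +
        (C t * C s' - C s * C t') * lin i ν * lin j μ := by
    simp only [det2, map_add, map_smul, smul_eq_C_mul]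
    ring
  rw [h]
  exact Ideal.add_mem _ (Ideal.mul_mem_left _ _ (lin_mem (hN i)))
    (Ideal.mul_mem_left _ _ (lin_mem (hN j)))

theorem IsAdmissible.isRadical_rankIdeal (hK : IsAdmissible c S K) :
    (rankIdeal (centerFamily c S) K ⊤).IsRadical := by
  induction S using Finset.strongInduction with
  | H S ih =>
  obtain rfl | ⟨n, hn⟩ := S.eq_empty_or_nonempty
  · exact isRadical_rankIdeal_of_forall_eq_top fun j => by simp [centerFamily]
  have hK0 : ⊥ < K := by
    rw [bot_lt_iff_ne_bot]
    rintro rfl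
    simpa using hK.finrank_eq
  obtain ⟨μ, hμ, hμ0, hreg⟩ := hK.exists_regular hn hK0 {⊥} (Set.finite_singleton _)
    (by simpa using hK0.ne')
  simp only [sup_bot_eq] at hreg
  replace hμ0 : μ ≠ 0 := by simpa using hμ0
  refine isRadical_of_sup_span _ (lin n μ) (isHomogeneous_lin n μ) isHomogeneous_rankIdeal hreg ?_
  rw [rankIdeal_sup_span, centerFamily_of_mem hn]
  have hμK : ℂ ∙ μ < K := by
    refine lt_of_le_of_ne ((Submodule.span_singleton_le_iff_mem _ _).2 hμ) fun h => ?_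
    have := hK.finrank_eq
    rw [← h, finrank_span_singleton hμ0] at this
    omega
  obtain ⟨ν, hν, hνμ, hreg⟩ := hK.exists_regular hn hμK {ℂ ∙ μ} (Set.finite_singleton _)
    (by simpa using hμK.not_ge)
  have hμν := sup_span_singleton_eq_of_finrank_eq_two hK.finrank_eq hμ hμ0 hν (hνμ _ rfl)
  have hμn : ∀ A : Submodule ℂ Vec4, μ ∈ A ⊔ ℂ ∙ μ :=
    fun A => Submodule.mem_sup_right (Submodule.mem_span_singleton_self μ)
  have hle : centerFamily c S ≤ Function.update (centerFamily c S) n (ℂ ∙ c n ⊔ ℂ ∙ μ) := by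
    rw [le_update_self_iff, centerFamily_of_mem hn]
    exact le_sup_left
  refine isRadical_of_mul_mem _ _ (lin n ν) (rankIdeal_mono (fun j => ?_) le_rfl le_rfl)
    (mul_mem_of_mem_rankIdeal (fun j p hp => ?_)
      (fun p hp q hq i j => Ideal.mul_mem_left _ _ (det2_mem hp hq i j))
      fun p hp q hq r hr i j k => Ideal.mul_mem_left _ _ (det3_mem hp hq hr i j k)) hreg ?_ ?_
  · by_cases hj : j = n
    · subst hj
      rw [Function.update_self, centerFamily_of_mem hn]
    · rw [Function.update_of_ne hj]
      exact le_sup_left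
  · obtain ⟨x, hx, y, hy, rfl⟩ := Submodule.mem_sup.1 hp
    obtain ⟨s, rfl⟩ := Submodule.mem_span_singleton.1 hy
    rw [map_add, mul_add]
    refine Ideal.add_mem _ (Ideal.mul_mem_left _ _ (lin_mem (hle j hx)))
      (lin_mul_lin_mem hν ?_ (K.smul_mem s hμ) j)
    rw [Function.update_self]
    exact Submodule.smul_mem _ _ (hμn _)
  · rw [rankIdeal_sup_eq (fun j => hμn _) hμν]
    exact isRadical_rankIdeal_bot_top hμ0 fun j => hμn _
  · rw [rankIdeal_sup_span, Function.update_self, Function.update_idem, sup_assoc, hμν, sup_comm]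
    refine isRadical_rankIdeal_of_finrank_eq_three (n := n) ?_ ?_ ?_
    · rw [Function.update_self, hK.finrank_sup hn]
    · rw [Function.update_self]
      exact le_sup_left
    · rw [Function.update_idem, update_centerFamily_top]
      exact ih _ (Finset.erase_ssubset hn) (hK.mono (Finset.erase_subset _ _))

theorem mem_sup_span_singleton_exchange {A : Submodule ℂ Vec4} {x μ : Vec4} (h : x ∈ A ⊔ ℂ ∙ μ)
    (hx : x ∉ A) : μ ∈ A ⊔ ℂ ∙ x := by
  obtain ⟨y, hy, z, hz, rfl⟩ := Submodule.mem_sup.1 h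
  obtain ⟨s, rfl⟩ := Submodule.mem_span_singleton.1 hz
  have hs : s ≠ 0 := by
    rintro rfl
    exact hx (by simpa using hy)
  rw [← Submodule.smul_mem_iff _ hs]
  have := (A ⊔ ℂ ∙ (y + s • μ)).sub_mem
    (Submodule.mem_sup_right (Submodule.mem_span_singleton_self _)) (Submodule.mem_sup_left hy)
  simpa using this

/-- The points `c j` are pairwise distinct in projective space and no four are collinear. -/
structure IsGeneral (c : Fin m → Vec4) : Prop where
  ne_zero : ∀ i, c i ≠ 0
  notMem : ∀ i j, i ≠ j → c i ∉ ℂ ∙ c j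
  unique : ∀ n i j k, i ≠ n → j ≠ n → k ≠ n → j ≠ i → k ≠ i →
    c j ∈ ℂ ∙ c n ⊔ ℂ ∙ c i → c k ∈ ℂ ∙ c n ⊔ ℂ ∙ c i → j = k

theorem IsGeneral.isAdmissible (hc : IsGeneral c) {μ : Vec4}
    (hμ : ∀ i k, μ ∉ ℂ ∙ c n ⊔ ℂ ∙ c i ⊔ ℂ ∙ c k) :
    IsAdmissible c (S.erase n) (ℂ ∙ c n ⊔ ℂ ∙ μ) := by
  have hμn : μ ∉ ℂ ∙ c n := fun h => hμ n n (Submodule.mem_sup_left (Submodule.mem_sup_left h))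
  have hmem : ∀ i j, c j ∈ (ℂ ∙ c n ⊔ ℂ ∙ μ) ⊔ ℂ ∙ c i → c j ∈ ℂ ∙ c n ⊔ ℂ ∙ c i := by
    intro i j h
    by_contra h2
    rw [sup_right_comm] at h
    exact hμ i j (mem_sup_span_singleton_exchange h h2)
  refine ⟨?_, fun i hi h => ?_, fun i hi j hj k hk hji hki h1 h2 => ?_⟩
  · rw [finrank_sup_span_singleton hμn, finrank_span_singleton (hc.ne_zero n)]
  · exact hμ i i (Submodule.mem_sup_left (mem_sup_span_singleton_exchange h
      (hc.notMem i n (Finset.ne_of_mem_erase hi))))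
  · exact hc.unique n i j k (Finset.ne_of_mem_erase hi) (Finset.ne_of_mem_erase hj)
      (Finset.ne_of_mem_erase hk) hji hki (hmem i j h1) (hmem i k h2)

theorem finrank_sup_span_singleton_le (A : Submodule ℂ Vec4) (x : Vec4) :
    finrank ℂ ↥(A ⊔ ℂ ∙ x) ≤ finrank ℂ A + 1 := by
  by_cases h : x ∈ A
  · rw [sup_eq_left.2 ((Submodule.span_singleton_le_iff_mem _ _).2 h)]
    omega
  · exact (finrank_sup_span_singleton h).le

theorem ne_top_of_finrank_lt {A : Submodule ℂ Vec4} (h : finrank ℂ A < 4) : A ≠ ⊤ := by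
  rintro rfl
  simp at h

theorem IsGeneral.isRadical_rankIdeal (hc : IsGeneral c) (S : Finset (Fin m)) :
    (rankIdeal (centerFamily c S) ⊥ ⊤).IsRadical := by
  induction S using Finset.strongInduction with
  | H S ih =>
  obtain rfl | ⟨n, hn⟩ := S.eq_empty_or_nonempty
  · exact isRadical_rankIdeal_of_forall_eq_top fun j => by simp [centerFamily]
  have h1 : finrank ℂ (ℂ ∙ c n) = 1 := finrank_span_singleton (hc.ne_zero n)
  refine isRadical_rankIdeal_of_update n ⊤ (fun V hV => ?_)
    (Set.range fun x : Fin m × Fin m => ℂ ∙ c n ⊔ ℂ ∙ c x.1 ⊔ ℂ ∙ c x.2) (Set.finite_range _) ?_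
    fun μ _ hμ => ?_
  · have h2 := finrank_ann_add (ℂ ∙ c n)
    obtain ⟨u, hu0, hu⟩ := hV.exists_translate (H := ⊤) (n := n) (fun _ => trivial) le_top
      (by rw [centerFamily_of_mem hn]; omega)
      (by rw [centerFamily_of_mem hn, finrank_top, finrank_fintype_fun_eq_card, Fintype.card_fin]
          omega)
    exact ⟨u, notMem_ann_top hu0, hu⟩
  · rintro _ ⟨⟨i, k⟩, rfl⟩ h
    have h2 := finrank_sup_span_singleton_le (ℂ ∙ c n) (c i)
    have h3 := finrank_sup_span_singleton_le (ℂ ∙ c n ⊔ ℂ ∙ c i) (c k)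
    have h4 : finrank ℂ ↥(ℂ ∙ c n ⊔ ℂ ∙ c i ⊔ ℂ ∙ c k) < 4 := by omega
    exact ne_top_of_finrank_lt h4 (top_le_iff.1 h)
  rw [centerFamily_of_mem hn]
  have hK : IsAdmissible c (S.erase n) (ℂ ∙ c n ⊔ ℂ ∙ μ) :=
    hc.isAdmissible fun i k => hμ _ ⟨(i, k), rfl⟩
  set K := ℂ ∙ c n ⊔ ℂ ∙ μ
  have hKtop : K ≠ ⊤ := ne_top_of_finrank_lt (by rw [hK.finrank_eq]; omega)
  obtain ⟨ν, -, hνK, hreg⟩ := exists_regular_of_translate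
    (N := Function.update (centerFamily c S) n K) (K := K) (T := ⊤) n ⊤ (fun V hV => by
      obtain ⟨a, ha, b, -, hab⟩ := hV.exists_span_pair
      have hN : ∀ u ∈ ann K, u ∈ ann (Function.update (centerFamily c S) n K n) := by simp
      by_cases ha0 : a = 0
      · obtain ⟨u, hu, hu0⟩ := exists_mem_ann_ne_zero hKtop
        refine ⟨u, notMem_ann_top hu0, hV.update_of_span_pair (b := b) hu (fun j => ?_) (hN u hu)
          (Submodule.subset_span (by simp))⟩
        have h := hab j
        rw [ha0, Submodule.span_insert_zero] at h
        exact Submodule.span_mono (by simp) h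
      · exact ⟨a, notMem_ann_top ha0, hV.update_of_span_pair ha hab (hN a ha)
          (Submodule.subset_span (by simp))⟩)
    {K} (Set.finite_singleton _) (by simpa using hKtop)
  have h3 : finrank ℂ ↥(K ⊔ ℂ ∙ ν) = 3 := by
    rw [finrank_sup_span_singleton (hνK _ rfl), hK.finrank_eq]
  have hKn : ∀ p ∈ K, p ∈ Function.update (centerFamily c S) n K n := by simp
  refine isRadical_of_mul_mem _ _ (lin n ν) (rankIdeal_mono le_rfl bot_le le_rfl)
    (mul_mem_of_mem_rankIdeal (fun j p hp => Ideal.mul_mem_left _ _ (lin_mem hp))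
      (fun p hp q hq => lin_mul_det2_mem Submodule.mem_top (hKn p hp) Submodule.mem_top (hKn q hq)
        Submodule.mem_top)
      fun p hp q hq r hr i j k => Ideal.mul_mem_left _ _ (det3_mem hp hq hr i j k)) hreg ?_ ?_
  · refine isRadical_of_sup_span _ (lin n ν) (isHomogeneous_lin n ν) isHomogeneous_rankIdeal hreg ?_
    rw [rankIdeal_sup_span, Function.update_self, Function.update_idem]
    refine isRadical_rankIdeal_of_finrank_eq_three (n := n) ?_ ?_ ?_
    · rwa [Function.update_self]
    · rw [Function.update_self]
      exact le_sup_left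
    · rw [Function.update_idem, update_centerFamily_top]
      exact hK.isRadical_rankIdeal
  · rw [rankIdeal_sup_span, Function.update_self, Function.update_idem]
    refine isRadical_rankIdeal_of_finrank_eq_three (n := n) ?_ bot_le ?_
    · rwa [Function.update_self]
    · rw [Function.update_idem, update_centerFamily_top]
      exact ih _ (Finset.erase_ssubset hn)

end MainInduction

section Transfer

open Module

variable {m : ℕ} {𝒞 : Fin m → Camera} {c : Fin m → Vec4}

theorem exists_isCenter {C : Camera} (h : C.rank = 3) : ∃ c, IsCenter C c := by
  have h1 := LinearMap.finrank_range_add_finrank_ker C.mulVecLin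
  have h2 : finrank ℂ (LinearMap.range C.mulVecLin) = 3 := h
  rw [h2, finrank_fintype_fun_eq_card, Fintype.card_fin] at h1
  obtain ⟨c, hc, hc0⟩ := Submodule.exists_mem_ne_zero_of_ne_bot
    (fun h => by rw [h, finrank_bot] at h1; omega : LinearMap.ker C.mulVecLin ≠ ⊥)
  exact ⟨c, hc0, by simpa using hc⟩

theorem mem_span_of_mulVec_eq_zero {C : Camera} (h : C.rank = 3) {c : Vec4} (hc : IsCenter C c)
    {x : Vec4} (hx : C.mulVec x = 0) : x ∈ ℂ ∙ c := by
  have h1 := LinearMap.finrank_range_add_finrank_ker C.mulVecLin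
  have h2 : finrank ℂ (LinearMap.range C.mulVecLin) = 3 := h
  rw [h2, finrank_fintype_fun_eq_card, Fintype.card_fin] at h1
  have h3 : ℂ ∙ c = LinearMap.ker C.mulVecLin := by
    refine Submodule.eq_of_le_of_finrank_eq ?_ ?_
    · rw [Submodule.span_singleton_le_iff_mem]
      simpa using hc.2
    · rw [finrank_span_singleton hc.1]
      exact (Nat.add_left_cancel (n := 3) h1).symm
  rw [h3]
  simpa using hx

theorem exists_right_inverse {C : Camera} (h : C.rank = 3) :
    ∃ D : Matrix (Fin 4) (Fin 3) ℂ, C * D = 1 := by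
  rw [← Matrix.mulVec_surjective_iff_exists_right_inverse]
  have h2 : finrank ℂ (LinearMap.range C.mulVecLin) = 3 := h
  have h3 : LinearMap.range C.mulVecLin = ⊤ := Submodule.eq_top_of_finrank_eq (by simp [h2])
  exact LinearMap.range_eq_top.1 h3

theorem isGeneral_of_isCenter (harr : IsCameraArrangement 𝒞) (h4 : NoFourCollinear 𝒞)
    (hc : ∀ j, IsCenter (𝒞 j) (c j)) : IsGeneral c := by
  refine ⟨fun i => (hc i).1, fun i j hij h => ?_, fun n i j k hin hjn hkn hji hki hj hk => ?_⟩
  · obtain ⟨s, hs⟩ := Submodule.mem_span_singleton.1 h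
    refine harr.2.2 i j hij ⟨c i, hc i, (hc i).1, ?_⟩
    rw [← hs, Matrix.mulVec_smul, (hc j).2, smul_zero]
  · by_contra hjk
    have hcard : ({n, i, j, k} : Finset (Fin m)).card = 4 := by
      rw [Finset.card_insert_of_notMem, Finset.card_insert_of_notMem, Finset.card_pair hjk]
      · simp [hji.symm, hki.symm]
      · simp [hin.symm, hjn.symm, hkn.symm]
    refine h4 _ hcard ⟨ℂ ∙ c n ⊔ ℂ ∙ c i, ?_, fun a ha => ⟨c a, hc a, ?_⟩⟩
    · have h := finrank_sup_span_singleton_le (ℂ ∙ c n) (c i)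
      rwa [finrank_span_singleton (hc n).1] at h
    · simp only [Finset.coe_insert, Finset.coe_singleton, Set.mem_insert_iff,
        Set.mem_singleton_iff] at ha
      rcases ha with rfl | rfl | rfl | rfl
      · exact Submodule.mem_sup_left (Submodule.mem_span_singleton_self _)
      · exact Submodule.mem_sup_right (Submodule.mem_span_singleton_self _)
      · exact hj
      · exact hk

/-- Pulling back coordinates of points in the cone along back-projected lines. -/
def toLineRing (𝒞 : Fin m → Camera) : PtRing m →ₐ[ℂ] LineRing m :=
  aeval fun x => MmatPoly 𝒞 x.2 x.1

/-- The map induced by right inverses of the cameras. -/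
def ofLineRing (D : Fin m → Matrix (Fin 4) (Fin 3) ℂ) : LineRing m →ₐ[ℂ] PtRing m :=
  aeval fun x => lin x.2 fun r => D x.2 r x.1

theorem lin_eq_sum (j : Fin m) (p : Vec4) : lin j p = ∑ r, p r • (X (j, r) : PtRing m) :=
  Fintype.linearCombination_apply _ _ _

theorem toLineRing_lin (j : Fin m) (p : Vec4) :
    toLineRing 𝒞 (lin j p) = ∑ i, C ((𝒞 j).mulVec p i) * X (i, j) := by
  rw [lin_eq_sum, map_sum]
  simp only [map_smul, toLineRing, aeval_X, MmatPoly, Matrix.of_apply]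
  simp only [Finset.smul_sum, smul_eq_C_mul, Matrix.mulVec, dotProduct, map_sum, map_mul,
    Finset.sum_mul]
  rw [Finset.sum_comm]
  exact Finset.sum_congr rfl fun i _ => Finset.sum_congr rfl fun r _ => by ring

theorem toLineRing_ofLineRing {D : Fin m → Matrix (Fin 4) (Fin 3) ℂ} (hD : ∀ j, 𝒞 j * D j = 1)
    (f : LineRing m) : toLineRing 𝒞 (ofLineRing D f) = f := by
  have h : (toLineRing 𝒞).comp (ofLineRing D) = AlgHom.id ℂ _ := by
    refine MvPolynomial.algHom_ext fun x => ?_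
    have h1 : ∀ i, (𝒞 x.2).mulVec (fun r => D x.2 r x.1) i = (1 : Matrix (Fin 3) (Fin 3) ℂ) i x.1 :=
      fun i => by rw [← hD x.2]; rfl
    simp [ofLineRing, toLineRing_lin, h1, Matrix.one_apply]
  exact AlgHom.congr_fun h f

theorem ofLineRing_MmatPoly (D : Fin m → Matrix (Fin 4) (Fin 3) ℂ) (r : Fin 4) (j : Fin m) :
    ofLineRing D (MmatPoly 𝒞 r j) = lin j fun s => (D j * 𝒞 j) s r := by
  simp only [MmatPoly, Matrix.of_apply, ← smul_eq_C_mul]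
  rw [map_sum]
  simp only [map_smul, ofLineRing, aeval_X]
  simp only [← map_smul]
  rw [← map_sum]
  congr 1
  ext s
  simp [Matrix.mul_apply, mul_comm]

theorem ofLineRing_MmatPoly_sub_mem {D : Fin m → Matrix (Fin 4) (Fin 3) ℂ}
    (hD : ∀ j, 𝒞 j * D j = 1) (hr : ∀ j, (𝒞 j).rank = 3) (hc : ∀ j, IsCenter (𝒞 j) (c j))
    (r : Fin 4) (j : Fin m) :
    ofLineRing D (MmatPoly 𝒞 r j) - lin j (Pi.single r 1) ∈
      rankIdeal (fun j => ℂ ∙ c j) ⊥ ⊤ := by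
  rw [ofLineRing_MmatPoly, ← map_sub]
  refine lin_mem (mem_span_of_mulVec_eq_zero (hr j) (hc j) ?_)
  have h : (fun s => (D j * 𝒞 j) s r) = (D j * 𝒞 j).mulVec (Pi.single r 1) := by
    rw [Matrix.mulVec_single_one]; rfl
  rw [h, Matrix.mulVec_sub, Matrix.mulVec_mulVec, ← Matrix.mul_assoc, hD j, Matrix.one_mul,
    sub_self]

theorem ofLineRing_mem {D : Fin m → Matrix (Fin 4) (Fin 3) ℂ} (hD : ∀ j, 𝒞 j * D j = 1)
    (hr : ∀ j, (𝒞 j).rank = 3) (hc : ∀ j, IsCenter (𝒞 j) (c j)) {f : LineRing m}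
    (hf : f ∈ minorsIdeal 𝒞) : ofLineRing D f ∈ rankIdeal (fun j => ℂ ∙ c j) ⊥ ⊤ := by
  have h : minorsIdeal 𝒞 ≤ (rankIdeal (fun j => ℂ ∙ c j) ⊥ ⊤).comap (ofLineRing D) := by
    refine Ideal.span_le.2 ?_
    rintro _ ⟨ri, ci, -, -, rfl⟩
    have h1 : ∀ r j, Ideal.Quotient.mk (rankIdeal (fun j => ℂ ∙ c j) ⊥ ⊤)
        (ofLineRing D (MmatPoly 𝒞 r j)) = Ideal.Quotient.mk _ (lin j (Pi.single r 1)) :=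
      fun r j => Ideal.Quotient.eq.2 (ofLineRing_MmatPoly_sub_mem hD hr hc r j)
    have h2 := Ideal.Quotient.eq_zero_iff_mem.2 <|
      det3_mem (N := fun j => ℂ ∙ c j) (K := ⊥) (T := ⊤) (p := Pi.single (ri 0) 1)
        (q := Pi.single (ri 1) 1) (r := Pi.single (ri 2) 1) trivial trivial trivial
        (ci 0) (ci 1) (ci 2)
    rw [SetLike.mem_coe, Ideal.mem_comap, ← Ideal.Quotient.eq_zero_iff_mem, ← h2,
      Matrix.det_fin_three]
    simp only [det3, det2, Matrix.submatrix_apply, map_sub, map_add, map_mul, h1]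
    ring
  exact h hf

theorem forall_mem_of_single {I : Ideal (PtRing m)} (f : Vec4 → PtRing m)
    (hadd : ∀ x y, f (x + y) = f x + f y) (hsmul : ∀ (s : ℂ) x, f (s • x) = C s * f x)
    (h : ∀ r, f (Pi.single r 1) ∈ I) (x : Vec4) : f x ∈ I := by
  let W : Submodule ℂ Vec4 :=
    { carrier := {x | f x ∈ I}
      add_mem' := fun {x y} hx hy => by
        change f (x + y) ∈ I
        rw [hadd]
        exact I.add_mem hx hy
      zero_mem' := by
        change f 0 ∈ I
        have h0 := hsmul 0 0
        rw [zero_smul, map_zero, zero_mul] at h0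
        rw [h0]
        exact I.zero_mem
      smul_mem' := fun s x hx => by
        change f (s • x) ∈ I
        rw [hsmul]
        exact I.mul_mem_left _ hx }
  change x ∈ W
  rw [pi_eq_sum_univ' x]
  exact W.sum_mem fun r _ => W.smul_mem _ (h r)

theorem det_submatrix_mem (ri : Fin 3 → Fin 4) (ci : Fin 3 → Fin m) :
    ((MmatPoly 𝒞).submatrix ri ci).det ∈ minorsIdeal 𝒞 := by
  by_cases hr : Function.Injective ri
  · by_cases hci : Function.Injective ci
    · exact Ideal.subset_span ⟨ri, ci, hr, hci, rfl⟩
    · rw [Function.not_injective_iff] at hci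
      obtain ⟨i, j, hij, hne⟩ := hci
      rw [Matrix.det_zero_of_column_eq hne fun k => by simp [hij]]
      exact zero_mem _
  · rw [Function.not_injective_iff] at hr
    obtain ⟨i, j, hij, hne⟩ := hr
    rw [Matrix.det_zero_of_row_eq hne (by ext k; simp [hij])]
    exact zero_mem _

theorem toLineRing_mem (hc : ∀ j, IsCenter (𝒞 j) (c j)) {f : PtRing m}
    (hf : f ∈ rankIdeal (fun j => ℂ ∙ c j) ⊥ ⊤) : toLineRing 𝒞 f ∈ minorsIdeal 𝒞 := by
  have h : rankIdeal (fun j => ℂ ∙ c j) ⊥ ⊤ ≤ (minorsIdeal 𝒞).comap (toLineRing 𝒞) := by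
    refine rankIdeal_le (fun j p hp => ?_) (det2_bot_mem _) fun p _ q _ r _ i j k => ?_
    · obtain ⟨s, rfl⟩ := Submodule.mem_span_singleton.1 hp
      rw [Ideal.mem_comap, toLineRing_lin, Matrix.mulVec_smul, (hc j).2]
      simp
    · revert p
      refine fun p _ => forall_mem_of_single (fun p => det3 p q r i j k) ?_ ?_ (fun x => ?_) p
      · intro x y; simp only [det3, det2, map_add]; ring
      · intro s x; simp only [det3, det2, map_smul, smul_eq_C_mul]; ring
      refine forall_mem_of_single (fun q => det3 _ q r i j k) ?_ ?_ (fun y => ?_) q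
      · intro x y; simp only [det3, det2, map_add]; ring
      · intro s x; simp only [det3, det2, map_smul, smul_eq_C_mul]; ring
      refine forall_mem_of_single (fun r => det3 _ _ r i j k) ?_ ?_ (fun z => ?_) r
      · intro x y; simp only [det3, det2, map_add]; ring
      · intro s x; simp only [det3, det2, map_smul, smul_eq_C_mul]; ring
      have h1 : ∀ a b, toLineRing 𝒞 (lin a (Pi.single b 1)) = MmatPoly 𝒞 b a := by
        intro a b
        simp [toLineRing, lin]
      rw [Ideal.mem_comap]
      convert det_submatrix_mem (𝒞 := 𝒞) ![x, y, z] ![i, j, k] using 1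
      rw [Matrix.det_fin_three]
      simp only [det3, det2, map_add, map_sub, map_mul, h1]
      simp
      ring
  exact h hf

theorem isRadical_minorsIdeal (harr : IsCameraArrangement 𝒞) (h4 : NoFourCollinear 𝒞) :
    (minorsIdeal 𝒞).IsRadical := by
  choose c hc using fun j => exists_isCenter (harr.2.1 j)
  choose D hD using fun j => exists_right_inverse (harr.2.1 j)
  have hJ := (isGeneral_of_isCenter harr h4 hc).isRadical_rankIdeal Finset.univ
  have hN : centerFamily c Finset.univ = fun j => ℂ ∙ c j := by
    ext1 j
    simp [centerFamily]
  rw [hN] at hJ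
  rintro f ⟨n, hn⟩
  rw [← toLineRing_ofLineRing hD f]
  refine toLineRing_mem hc (hJ ⟨n, ?_⟩)
  rw [← map_pow]
  exact ofLineRing_mem hD harr.2.1 hc hn

end Transfer

end LineMultiview

/-- **Proposition 2.5.** If no four cameras are collinear, then the quotient `R/I_𝒞` is
reduced; equivalently, the ideal `I_𝒞` of 3×3 minors of `M(ℓ)` is radical. -/
theorem minorsIdeal_isRadical {m : ℕ} (𝒞 : Fin m → Camera)
    (harr : IsCameraArrangement 𝒞) (h4 : NoFourCollinear 𝒞) :
    (minorsIdeal 𝒞).IsRadical := by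
  exact LineMultiview.isRadical_minorsIdeal harr h4

end
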